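/- For every p ∈ (1, ∞) there exists a constant C_p > 0 independent of the dimension d ∈ ℕ such that for every f ∈ ℓ^p(ℤ^d): (i) ‖ sup_{t>0} P_t|f| ‖_{ℓ^p(ℤ^d)} ≤ C_p ‖f‖_{ℓ^p(ℤ^d)}, and (ii) ‖ g(f) ‖_{ℓ^p(ℤ^d)} ≤ C_p ‖f‖_{ℓ^p(ℤ^d)}, where g(f)(x) = (∫_0^∞ t |d/dt P_t f(x)|² dt)^{1/2} is the Littlewood–Paley square function of the semigroup. -/

import Mathlib

open MeasureTheory ENNReal

/-- The ℓ^p(ℤ^d) "norm" of a nonnegative (ℝ≥0∞-valued) function, `p ∈ (0,∞]`. -/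
noncomputable def lpZ (d : ℕ) (p : ℝ≥0∞) (g : (Fin d → ℤ) → ℝ≥0∞) : ℝ≥0∞ :=
  if p = ∞ then ⨆ x, g x else (∑' x, g x ^ p.toReal) ^ (1 / p.toReal)

/-- `x ↦ ‖f x‖₊` as an ℝ≥0∞-valued function. -/
noncomputable def nnC {d : ℕ} (f : (Fin d → ℤ) → ℂ) : (Fin d → ℤ) → ℝ≥0∞ :=
  fun x => (‖f x‖₊ : ℝ≥0∞)

/-- `|ξ|_sin = (Σ_k sin²(πξ_k))^{1/2}`. -/
noncomputable def sinNorm (d : ℕ) (ξ : Fin d → ℝ) : ℝ :=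
  Real.sqrt (∑ k, Real.sin (Real.pi * ξ k) ^ 2)

/-- The convolution kernel of the discrete Poisson semigroup `P_t`: the inverse Fourier
transform on `𝕋^d ≡ [-1/2,1/2)^d` of the multiplier `e^{-t|ξ|_sin}`. -/
noncomputable def poissonKer (d : ℕ) (t : ℝ) (z : Fin d → ℤ) : ℂ :=
  ∫ ξ in Set.Icc (fun _ => -(1 / 2 : ℝ)) (fun _ => (1 / 2 : ℝ)),
    Complex.exp (-(t : ℂ) * (sinNorm d ξ : ℂ)
      - 2 * Real.pi * Complex.I * ∑ k, (z k : ℂ) * (ξ k : ℂ))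

/-- The discrete Poisson semigroup `P_t` on ℤ^d, as a convolution operator. -/
noncomputable def poisson (d : ℕ) (t : ℝ) (f : (Fin d → ℤ) → ℂ) (x : Fin d → ℤ) : ℂ :=
  ∑' y, poissonKer d t (x - y) * f y


namespace PS

/-- the cube -/
def cube (d : ℕ) : Set (Fin d → ℝ) := Set.Icc (fun _ => -(1 / 2 : ℝ)) (fun _ => (1 / 2 : ℝ))

/-- phase -/
noncomputable def ph {d : ℕ} (z : Fin d → ℤ) (ξ : Fin d → ℝ) : ℝ :=
  2 * Real.pi * ∑ k, (z k : ℝ) * ξ k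

/-- kernels and derivatives -/
noncomputable def J (d n : ℕ) (t : ℝ) (z : Fin d → ℤ) : ℝ :=
  ∫ ξ in cube d, sinNorm d ξ ^ n * Real.exp (-t * sinNorm d ξ) * Real.cos (ph z ξ)

/-- the discrete Laplacian (negative of the one in the paper) -/
noncomputable def lap {d : ℕ} (g : (Fin d → ℤ) → ℝ) (x : Fin d → ℤ) : ℝ :=
  (1 / 4) * ∑ k, (g (x + Pi.single k 1) + g (x - Pi.single k 1) - 2 * g x)

/-- decay bound -/
noncomputable def eta (d : ℕ) (t : ℝ) : ℝ := ∫ ξ in cube d, Real.exp (-t * sinNorm d ξ)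

lemma sinNorm_nonneg (d : ℕ) (ξ : Fin d → ℝ) : 0 ≤ sinNorm d ξ := Real.sqrt_nonneg _

lemma sinNorm_le (d : ℕ) (ξ : Fin d → ℝ) : sinNorm d ξ ≤ d := by
  unfold sinNorm
  have h1 : ∑ k, Real.sin (Real.pi * ξ k) ^ 2 ≤ d := by
    calc ∑ k, Real.sin (Real.pi * ξ k) ^ 2 ≤ ∑ k : Fin d, (1 : ℝ) :=
          Finset.sum_le_sum fun k _ => Real.sin_sq_le_one _
      _ = d := by simp
  rw [Real.sqrt_le_left (by positivity)]
  refine h1.trans ?_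
  rcases Nat.eq_zero_or_pos d with rfl | h
  · simp
  · have : (1 : ℝ) ≤ d := by exact_mod_cast h
    nlinarith

lemma sinNorm_sq (d : ℕ) (ξ : Fin d → ℝ) :
    sinNorm d ξ ^ 2 = ∑ k, Real.sin (Real.pi * ξ k) ^ 2 :=
  Real.sq_sqrt (Finset.sum_nonneg fun _ _ => sq_nonneg _)

lemma sinNorm_cont (d : ℕ) : Continuous (sinNorm d) := by
  unfold sinNorm; fun_prop

lemma ph_cont {d : ℕ} (z : Fin d → ℤ) : Continuous (ph z) := by
  unfold ph; fun_prop

lemma cube_compact (d : ℕ) : IsCompact (cube d) := isCompact_Icc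

lemma int_cube {d : ℕ} {f : (Fin d → ℝ) → ℝ} (hf : Continuous f) :
    Integrable f (volume.restrict (cube d)) :=
  hf.continuousOn.integrableOn_compact (cube_compact d)

lemma J_cont (d n : ℕ) (t : ℝ) (z : Fin d → ℤ) : Continuous fun ξ =>
    sinNorm d ξ ^ n * Real.exp (-t * sinNorm d ξ) * Real.cos (ph z ξ) := by
  have := sinNorm_cont d
  have := ph_cont z
  fun_prop

instance (d : ℕ) : IsFiniteMeasure (volume.restrict (cube d)) :=
  ⟨by rw [Measure.restrict_apply_univ]; exact (cube_compact d).measure_lt_top⟩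

lemma J_hasDerivAt (d n : ℕ) (t : ℝ) (z : Fin d → ℤ) :
    HasDerivAt (fun t => J d n t z) (-J d (n + 1) t z) t := by
  have h := hasDerivAt_integral_of_dominated_loc_of_deriv_le (𝕜 := ℝ) (μ := volume.restrict (cube d))
    (F := fun t ξ => sinNorm d ξ ^ n * Real.exp (-t * sinNorm d ξ) * Real.cos (ph z ξ))
    (F' := fun t ξ => -(sinNorm d ξ ^ (n + 1) * Real.exp (-t * sinNorm d ξ) * Real.cos (ph z ξ)))
    (x₀ := t) (s := Metric.ball t 1)
    (bound := fun _ => (d : ℝ) ^ (n + 1) * Real.exp ((|t| + 1) * d))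
    (Metric.ball_mem_nhds t one_pos)
    (Filter.Eventually.of_forall fun s => (J_cont d n s z).aestronglyMeasurable)
    (int_cube (J_cont d n t z))
    ((J_cont d (n + 1) t z).neg.aestronglyMeasurable)
    (Filter.Eventually.of_forall fun ξ s hs => ?_)
    (integrable_const _)
    (Filter.Eventually.of_forall fun ξ s hs => ?_)
  · have := h.2
    simp only [integral_neg] at this
    exact this
  · rw [norm_neg, Real.norm_eq_abs, abs_mul, abs_mul, abs_of_nonneg (pow_nonneg (sinNorm_nonneg d ξ) _),
      abs_of_pos (Real.exp_pos _)]
    have hs' : |s| ≤ |t| + 1 := by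
      rw [Metric.mem_ball, Real.dist_eq] at hs
      have := abs_sub_abs_le_abs_sub s t
      linarith
    have h1 : sinNorm d ξ ^ (n + 1) ≤ (d : ℝ) ^ (n + 1) :=
      pow_le_pow_left₀ (sinNorm_nonneg d ξ) (sinNorm_le d ξ) _
    have h2 : Real.exp (-s * sinNorm d ξ) ≤ Real.exp ((|t| + 1) * d) := by
      apply Real.exp_le_exp.2
      calc -s * sinNorm d ξ ≤ |s| * sinNorm d ξ :=
            mul_le_mul_of_nonneg_right (neg_le_abs s) (sinNorm_nonneg d ξ)
        _ ≤ (|t| + 1) * d := mul_le_mul hs' (sinNorm_le d ξ) (sinNorm_nonneg d ξ) (by positivity)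
    calc sinNorm d ξ ^ (n + 1) * Real.exp (-s * sinNorm d ξ) * |Real.cos (ph z ξ)|
        ≤ ((d : ℝ) ^ (n + 1) * Real.exp ((|t| + 1) * d)) * 1 := by
          apply mul_le_mul _ (Real.abs_cos_le_one _) (abs_nonneg _) (by positivity)
          exact mul_le_mul h1 h2 (Real.exp_pos _).le (by positivity)
      _ = _ := mul_one _
  · have h1 : HasDerivAt (fun s : ℝ => -s * sinNorm d ξ) (-1 * sinNorm d ξ) s :=
      ((hasDerivAt_id s).neg).mul_const _
    have h2 := ((h1.exp).const_mul (sinNorm d ξ ^ n)).mul_const (Real.cos (ph z ξ))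
    exact h2.congr_deriv (by ring)

lemma ph_add {d : ℕ} (z w : Fin d → ℤ) (ξ : Fin d → ℝ) : ph (z + w) ξ = ph z ξ + ph w ξ := by
  simp [ph, add_mul, Finset.sum_add_distrib, mul_add]

lemma ph_neg {d : ℕ} (z : Fin d → ℤ) (ξ : Fin d → ℝ) : ph (-z) ξ = -ph z ξ := by
  simp [ph]

lemma ph_single {d : ℕ} (k : Fin d) (ξ : Fin d → ℝ) :
    ph (Pi.single k 1) ξ = 2 * (Real.pi * ξ k) := by
  unfold ph
  rw [Finset.sum_eq_single k]
  · simp; ring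
  · intro b _ hb; simp [Pi.single_eq_of_ne hb]
  · simp

lemma J_lap (d n : ℕ) (t : ℝ) (z : Fin d → ℤ) : lap (J d n t) z = -J d (n + 2) t z := by
  unfold lap J
  have h : ∀ k : Fin d, (∫ ξ in cube d, sinNorm d ξ ^ n * Real.exp (-t * sinNorm d ξ) * Real.cos (ph (z + Pi.single k 1) ξ))
     + (∫ ξ in cube d, sinNorm d ξ ^ n * Real.exp (-t * sinNorm d ξ) * Real.cos (ph (z - Pi.single k 1) ξ))
     - 2 * (∫ ξ in cube d, sinNorm d ξ ^ n * Real.exp (-t * sinNorm d ξ) * Real.cos (ph z ξ))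
     = ∫ ξ in cube d, -4 * (Real.sin (Real.pi * ξ k) ^ 2 * (sinNorm d ξ ^ n * Real.exp (-t * sinNorm d ξ) * Real.cos (ph z ξ))) := by
    intro k
    rw [← integral_add (int_cube (J_cont d n t _)) (int_cube (J_cont d n t _)),
      ← integral_const_mul]
    refine (integral_sub ((int_cube (J_cont d n t _)).add (int_cube (J_cont d n t _)))
        ((int_cube (J_cont d n t _)).const_mul _)).symm.trans ?_
    congr 1
    funext ξ
    simp only [Pi.add_apply]
    rw [sub_eq_add_neg z, ph_add, ph_add, ph_neg, ph_single, Real.cos_add, Real.cos_add, Real.cos_neg, Real.sin_neg,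
      Real.cos_two_mul, Real.cos_sq']
    ring
  simp only [h]
  rw [← integral_finsetSum, ← integral_const_mul, ← integral_neg]
  · congr 1
    funext ξ
    rw [← Finset.mul_sum, ← Finset.sum_mul, ← sinNorm_sq]
    ring
  · intro k _
    apply int_cube
    have := sinNorm_cont d
    have := ph_cont z
    fun_prop

lemma J_symm (d n : ℕ) (t : ℝ) (z : Fin d → ℤ) : J d n t (-z) = J d n t z := by
  unfold J; simp [ph_neg]

lemma sinNorm_neg (d : ℕ) (ξ : Fin d → ℝ) : sinNorm d (-ξ) = sinNorm d ξ := by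
  simp [sinNorm]

lemma sin_int (d : ℕ) (t : ℝ) (z : Fin d → ℤ) :
    ∫ ξ in cube d, Real.exp (-t * sinNorm d ξ) * Real.sin (ph z ξ) = 0 := by
  have h := (Measure.measurePreserving_neg (volume : Measure (Fin d → ℝ))).setIntegral_preimage_emb
    (MeasurableEquiv.neg _).measurableEmbedding
    (fun ξ => Real.exp (-t * sinNorm d ξ) * Real.sin (ph z ξ)) (cube d)
  have hc : (Neg.neg ⁻¹' cube d : Set (Fin d → ℝ)) = cube d := by
    ext ξ
    simp only [cube, Set.mem_preimage, Set.mem_Icc, Pi.le_def, Pi.neg_apply]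
    constructor
    · rintro ⟨a, b⟩; exact ⟨fun i => by linarith [b i], fun i => by linarith [a i]⟩
    · rintro ⟨a, b⟩; exact ⟨fun i => by linarith [b i], fun i => by linarith [a i]⟩
  rw [hc] at h
  have h2 : ∀ ξ : Fin d → ℝ, Real.exp (-t * sinNorm d (-ξ)) * Real.sin (ph z (-ξ))
      = -(Real.exp (-t * sinNorm d ξ) * Real.sin (ph z ξ)) := by
    intro ξ
    have : ph z (-ξ) = - ph z ξ := by simp [ph]
    rw [this, sinNorm_neg, Real.sin_neg]; ring
  simp only [h2, integral_neg] at h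
  linarith

lemma ker_eq (d : ℕ) (t : ℝ) (z : Fin d → ℤ) : poissonKer d t z = (J d 0 t z : ℂ) := by
  unfold poissonKer
  have h : ∀ ξ : Fin d → ℝ, Complex.exp (-(t : ℂ) * (sinNorm d ξ : ℂ)
      - 2 * Real.pi * Complex.I * ∑ k, (z k : ℂ) * (ξ k : ℂ))
      = ((Real.exp (-t * sinNorm d ξ) * Real.cos (ph z ξ) : ℝ) : ℂ)
        - ((Real.exp (-t * sinNorm d ξ) * Real.sin (ph z ξ) : ℝ) : ℂ) * Complex.I := by
    intro ξ
    have : -(t : ℂ) * (sinNorm d ξ : ℂ) - 2 * Real.pi * Complex.I * ∑ k, (z k : ℂ) * (ξ k : ℂ)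
      = ((-t * sinNorm d ξ : ℝ) : ℂ) + ((-ph z ξ : ℝ) : ℂ) * Complex.I := by
      simp only [ph]; push_cast; ring
    rw [this, Complex.exp_add, Complex.exp_mul_I, ← Complex.ofReal_cos, ← Complex.ofReal_sin,
      ← Complex.ofReal_exp, Real.cos_neg, Real.sin_neg]
    push_cast; ring
  have hc1 : Continuous fun ξ => Real.exp (-t * sinNorm d ξ) * Real.cos (ph z ξ) := by
    have := sinNorm_cont d
    have := ph_cont z
    fun_prop
  have hc2 : Continuous fun ξ => Real.exp (-t * sinNorm d ξ) * Real.sin (ph z ξ) := by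
    have := sinNorm_cont d
    have := ph_cont z
    fun_prop
  simp only [h]
  rw [integral_sub, integral_mul_const, integral_complex_ofReal, integral_complex_ofReal]
  · have := sin_int d t z
    unfold cube at this
    rw [this]
    simp [J, cube]
  · exact (int_cube hc1).ofReal
  · exact (int_cube hc2).ofReal.mul_const _

lemma one_dim (n : ℤ) : ∫ x in Set.Icc (-(1 / 2 : ℝ)) (1 / 2), Complex.exp (-(2 * Real.pi * Complex.I * n) * x)
    = if n = 0 then 1 else 0 := by
  rw [integral_Icc_eq_integral_Ioc, ← intervalIntegral.integral_of_le (by norm_num)]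
  split_ifs with h
  · subst h; simp; norm_num
  · rw [integral_exp_mul_complex]
    · rw [_root_.div_eq_zero_iff]; left
      rw [sub_eq_zero]
      have : -(2 * Real.pi * Complex.I * n) * ((-(1 / 2 : ℝ) : ℝ) : ℂ)
        = -(2 * Real.pi * Complex.I * n) * ((1 / 2 : ℝ) : ℂ) + n * (2 * Real.pi * Complex.I) := by
        push_cast; ring
      rw [this, Complex.exp_add, Complex.exp_int_mul_two_pi_mul_I, mul_one]
    · simp [h, Real.pi_ne_zero]

lemma J_zero (d : ℕ) (z : Fin d → ℤ) : J d 0 0 z = if z = 0 then 1 else 0 := by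
  have h1 : poissonKer d 0 z = ∏ k, ∫ x in Set.Icc (-(1 / 2 : ℝ)) (1 / 2),
      Complex.exp (-(2 * Real.pi * Complex.I * (z k)) * x) := by
    unfold poissonKer
    rw [← integral_fintype_prod_eq_prod (μ := fun _ => volume.restrict (Set.Icc (-(1 / 2 : ℝ)) (1 / 2)))
      (fun k (x : ℝ) => Complex.exp (-(2 * Real.pi * Complex.I * (z k)) * x)),
      ← Measure.restrict_pi_pi, Set.pi_univ_Icc]
    congr 1
    funext ξ
    rw [← Complex.exp_sum]
    congr 1
    rw [Finset.mul_sum]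
    simp [← Finset.sum_neg_distrib]
    refine Finset.sum_congr rfl fun k _ => by ring
  rw [ker_eq] at h1
  simp only [one_dim] at h1
  have h2 : (∏ k, (if z k = 0 then (1 : ℂ) else 0)) = ((if z = 0 then (1 : ℝ) else 0 : ℝ) : ℂ) := by
    split_ifs with h
    · subst h; simp
    · obtain ⟨k, hk⟩ := Function.ne_iff.1 h
      rw [Finset.prod_eq_zero (Finset.mem_univ k)]
      · simp
      · simpa using hk
  rw [h2] at h1
  exact_mod_cast h1

lemma abs_J_le (d n : ℕ) (t : ℝ) (z : Fin d → ℤ) : |J d n t z| ≤ (d : ℝ) ^ n * eta d t := by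
  unfold J eta
  rw [← integral_const_mul, ← Real.norm_eq_abs]
  have := sinNorm_cont d
  refine norm_integral_le_of_norm_le (int_cube (by fun_prop)) (Filter.Eventually.of_forall fun ξ => ?_)
  rw [Real.norm_eq_abs, abs_mul, abs_mul, abs_of_nonneg (pow_nonneg (sinNorm_nonneg d ξ) _),
      abs_of_pos (Real.exp_pos _)]
  have h1 : sinNorm d ξ ^ n ≤ (d : ℝ) ^ n :=
      pow_le_pow_left₀ (sinNorm_nonneg d ξ) (sinNorm_le d ξ) _
  calc _ ≤ ((d : ℝ) ^ n * Real.exp (-t * sinNorm d ξ)) * 1 := by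
        apply mul_le_mul _ (Real.abs_cos_le_one _) (abs_nonneg _) (by positivity)
        gcongr
    _ = _ := mul_one _

lemma abs_tJ1_le (d : ℕ) (t : ℝ) (ht : 0 ≤ t) (z : Fin d → ℤ) : |t * J d 1 t z| ≤ 2 * eta d (t / 2) := by
  unfold J eta
  rw [← integral_const_mul, ← integral_const_mul, ← Real.norm_eq_abs]
  have := sinNorm_cont d
  refine norm_integral_le_of_norm_le (int_cube (by fun_prop)) (Filter.Eventually.of_forall fun ξ => ?_)
  have hs := sinNorm_nonneg d ξ
  set s := sinNorm d ξ
  rw [Real.norm_eq_abs, abs_mul, abs_mul, abs_mul, abs_of_nonneg ht, abs_of_nonneg (pow_nonneg hs _),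
      abs_of_pos (Real.exp_pos _)]
  have h1 : t * s / 2 ≤ Real.exp (t * s / 2) := by linarith [Real.add_one_le_exp (t * s / 2)]
  have h2 : Real.exp (-t * s) * Real.exp (t * s / 2) = Real.exp (-(t / 2) * s) := by
    rw [← Real.exp_add]; congr 1; ring
  calc t * (s ^ 1 * Real.exp (-t * s) * |Real.cos (ph z ξ)|)
      = (t * s) * Real.exp (-t * s) * |Real.cos (ph z ξ)| := by ring
    _ ≤ (2 * Real.exp (-(t / 2) * s)) * 1 := by
        apply mul_le_mul _ (Real.abs_cos_le_one _) (abs_nonneg _) (by positivity)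
        rw [← h2]
        nlinarith [Real.exp_pos (-t * s)]
    _ = _ := mul_one _

lemma sinNorm_pos_ae (d : ℕ) (hd : 0 < d) : ∀ᵐ ξ ∂(volume.restrict (cube d)), 0 < sinNorm d ξ := by
  have h0 : ∀ᵐ ξ ∂(volume : Measure (Fin d → ℝ)), ξ ⟨0, hd⟩ ≠ 0 := by
    rw [ae_iff]
    simp only [not_not]
    exact Measure.pi_hyperplane (fun _ => volume) _ _
  rw [ae_restrict_iff' (cube_compact d).measurableSet]
  filter_upwards [h0] with ξ hξ hc
  apply Real.sqrt_pos.2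
  refine Finset.sum_pos' (fun _ _ => sq_nonneg _) ⟨⟨0, hd⟩, Finset.mem_univ _, ?_⟩
  apply pow_pos_of_ne_zero
  have h1 := hc.1 ⟨0, hd⟩
  have h2 := hc.2 ⟨0, hd⟩
  simp only at h1 h2
  have := Real.pi_pos
  intro h
  rw [Real.sin_eq_zero_iff_of_lt_of_lt (by nlinarith) (by nlinarith)] at h
  rcases mul_eq_zero.1 h with h | h
  · exact Real.pi_ne_zero h
  · exact hξ h
where
  pow_pos_of_ne_zero {a : ℝ} (h : a ≠ 0) : 0 < a ^ 2 := by positivity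

lemma eta_tendsto (d : ℕ) (hd : 0 < d) : Filter.Tendsto (eta d) Filter.atTop (nhds 0) := by
  have := sinNorm_cont d
  have h := tendsto_integral_filter_of_dominated_convergence (μ := volume.restrict (cube d))
    (l := Filter.atTop) (F := fun (t : ℝ) ξ => Real.exp (-t * sinNorm d ξ)) (f := fun _ => 0)
    (fun _ => 1)
    (Filter.Eventually.of_forall fun t => Continuous.aestronglyMeasurable (by fun_prop))
    (by
      filter_upwards [Filter.eventually_ge_atTop 0] with t ht
      refine Filter.Eventually.of_forall fun ξ => ?_
      rw [Real.norm_eq_abs, abs_of_pos (Real.exp_pos _), Real.exp_le_one_iff]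
      nlinarith [sinNorm_nonneg d ξ])
    (integrable_const _)
    (by
      filter_upwards [sinNorm_pos_ae d hd] with ξ hξ
      apply Real.tendsto_exp_atBot.comp
      simp only [neg_mul]
      exact Filter.tendsto_neg_atTop_atBot.comp (Filter.tendsto_id.atTop_mul_const hξ))
  rw [integral_zero] at h
  exact h

lemma eta_pos (d : ℕ) (t : ℝ) : J d 0 t 0 = eta d t := by
  unfold J eta; simp [ph]

lemma eta_zero (d : ℕ) : eta d 0 = 1 := by
  rw [← eta_pos, J_zero]; simp

lemma J_dim0 (t : ℝ) (z : Fin 0 → ℤ) : J 0 0 t z = 1 := by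
  have h := J_zero 0 z
  have hz : z = 0 := Subsingleton.elim _ _
  rw [if_pos hz] at h
  rw [← h]
  unfold J; simp [sinNorm]

lemma J1_dim0 (n : ℕ) (t : ℝ) (z : Fin 0 → ℤ) : J 0 (n+1) t z = 0 := by
  unfold J; simp [sinNorm]

lemma eta_le_one (d : ℕ) (t : ℝ) (ht : 0 ≤ t) : eta d t ≤ 1 := by
  rw [← eta_zero d]
  unfold eta
  have := sinNorm_cont d
  apply integral_mono (int_cube (by fun_prop)) (int_cube (by fun_prop))
  intro ξ
  simp only
  apply Real.exp_le_exp.2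
  nlinarith [sinNorm_nonneg d ξ]

end PS


namespace PS

lemma snd_test {F F1 : ℝ → ℝ} {F2 t0 : ℝ} (hF : ∀ t, HasDerivAt F (F1 t) t)
    (hF1 : HasDerivAt F1 F2 t0) (hm : IsLocalMin F t0) : F1 t0 = 0 ∧ 0 ≤ F2 := by
  have hd : deriv F = F1 := funext fun t => (hF t).deriv
  have h1 : F1 t0 = 0 := hm.hasDerivAt_eq_zero (hF t0)
  refine ⟨h1, ?_⟩
  by_contra hneg
  push Not at hneg
  have hM : IsLocalMax F t0 := by
    apply isLocalMax_of_deriv_deriv_neg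
    · rw [hd, hF1.deriv]; exact hneg
    · rw [hd, h1]
    · exact (hF t0).continuousAt
  have hc : F =ᶠ[nhds t0] fun _ => F t0 := by
    filter_upwards [hm, hM] with t a b
    exact le_antisymm b a
  have hc1 : F1 =ᶠ[nhds t0] fun _ => 0 := by
    have := hc.deriv
    rw [hd] at this
    simpa using this
  have : F2 = 0 := by
    rw [← hF1.deriv, hc1.deriv_eq]; simp
  linarith

/-- squared euclidean length -/
noncomputable def nsq {d : ℕ} (x : Fin d → ℤ) : ℝ := ∑ k, (x k : ℝ) ^ 2

lemma lap_nsq {d : ℕ} (x : Fin d → ℤ) : lap nsq x = d / 2 := by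
  have h : ∀ k : Fin d, nsq (x + Pi.single k 1) + nsq (x - Pi.single k 1) - 2 * nsq x = 2 := by
    intro k
    unfold nsq
    rw [Finset.mul_sum, ← Finset.sum_add_distrib, ← Finset.sum_sub_distrib]
    rw [Finset.sum_eq_single k]
    · simp; ring
    · intro b _ hb; simp [Pi.single_eq_of_ne hb]; ring
    · simp
  unfold lap
  simp only [h]
  simp; ring

lemma lap_add_mul {d : ℕ} (g h : (Fin d → ℤ) → ℝ) (c e : ℝ) (x : Fin d → ℤ) :
    lap (fun y => g y + c * (h y + e)) x = lap g x + c * lap h x := by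
  unfold lap
  rw [mul_left_comm c, ← mul_add]
  congr 1
  rw [Finset.mul_sum, ← Finset.sum_add_distrib]
  exact Finset.sum_congr rfl fun k _ => by ring

theorem minP {d : ℕ} (β : ℝ) (hβ : 0 ≤ β) (w w1 w2 : ℝ → (Fin d → ℤ) → ℝ)
    (h1 : ∀ t x, HasDerivAt (fun t => w t x) (w1 t x) t)
    (h2 : ∀ t x, HasDerivAt (fun t => w1 t x) (w2 t x) t)
    (heq : ∀ t x, 0 < t → w2 t x - β / t * w1 t x + lap (w t) x = 0)
    (B : ℝ) (hB : ∀ t x, 0 ≤ t → -B ≤ w t x) (h0 : ∀ x, 0 ≤ w 0 x)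
    (hT : ∀ δ : ℝ, 0 < δ → ∃ T0 : ℝ, ∀ T x, T0 ≤ T → -δ ≤ w T x) :
    ∀ t x, 0 ≤ t → 0 ≤ w t x := by
  intro t1 x1 ht1
  by_contra hneg
  push Not at hneg
  set δ := -w t1 x1 / 2 with hδ
  have hδ0 : 0 < δ := by linarith
  obtain ⟨T0, hT0⟩ := hT δ hδ0
  set T := max T0 (t1 + 1) with hTd
  have hTT : ∀ x, -δ ≤ w T x := fun x => hT0 T x (le_max_left _ _)
  have hTt : t1 + 1 ≤ T := le_max_right _ _
  set C : ℝ := d / 4 + 1 with hC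
  have hC0 : 0 < C := by positivity
  let e : ℝ → ℝ := fun t => C * (2 * T * t - t ^ 2)
  have he : ∀ t, 0 ≤ t → t ≤ T → 0 ≤ e t := fun t a b => by
    apply mul_nonneg hC0.le; nlinarith
  have hn : ∀ x : Fin d → ℤ, 0 ≤ nsq x := fun x => Finset.sum_nonneg fun _ _ => sq_nonneg _
  set b1 := nsq x1 + e t1 with hb1
  have hb10 : 0 ≤ b1 := add_nonneg (hn _) (he _ ht1 (by linarith))
  set ε := δ / (2 * (b1 + 1)) with hε
  have hε0 : 0 < ε := by positivity
  have hεb : ε * b1 < δ := by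
    rw [hε, div_mul_eq_mul_div, div_lt_iff₀ (by positivity)]
    nlinarith
  let F : (Fin d → ℤ) → ℝ → ℝ := fun x t => w t x + ε * (nsq x + e t)
  let F1 : (Fin d → ℤ) → ℝ → ℝ := fun x t => w1 t x + ε * (C * (2 * T - 2 * t))
  have hF : ∀ x t, HasDerivAt (F x) (F1 x t) t := by
    intro x t
    have a1 : HasDerivAt e (C * (2 * T - 2 * t)) t := by
      have := (((hasDerivAt_id t).const_mul (2 * T)).sub ((hasDerivAt_id t).pow 2)).const_mul C
      refine this.congr_deriv ?_
      simp
    exact (h1 t x).add ((a1.const_add _).const_mul ε)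
  have hF1 : ∀ x t, HasDerivAt (F1 x) (w2 t x + ε * (C * (-2))) t := by
    intro x t
    have := ((((hasDerivAt_id t).const_mul (2 : ℝ)).const_sub (2 * T)).const_mul C).const_mul ε
    refine ((h2 t x).add this).congr_deriv ?_
    simp
  have hF11 : F x1 t1 < -δ := by
    have : w t1 x1 = - (2 * δ) := by rw [hδ]; ring
    simp only [F]
    rw [this, ← hb1]; linarith
  -- finite set
  set R := B / ε with hR
  obtain ⟨m, hm⟩ := exists_nat_ge (max R (nsq x1))
  let S : Finset (Fin d → ℤ) := Finset.Icc (fun _ => -(m : ℤ)) (fun _ => (m : ℤ))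
  have hS : ∀ x, x ∉ S → (m : ℝ) ≤ nsq x := by
    intro x hx
    by_contra hlt
    push Not at hlt
    apply hx
    have hk : ∀ k, |x k| ≤ m := by
      intro k
      have a1 : ((x k : ℝ)) ^ 2 ≤ nsq x :=
        Finset.single_le_sum (f := fun k => ((x k : ℝ)) ^ 2) (fun _ _ => sq_nonneg _) (Finset.mem_univ k)
      have a2 : |x k| ≤ (x k) ^ 2 := by
        rw [← sq_abs]
        rcases eq_or_lt_of_le (abs_nonneg (x k)) with h | h
        · rw [← h]; simp
        · nlinarith
      have a3 : ((x k ^ 2 : ℤ) : ℝ) ≤ ((m : ℤ) : ℝ) := by push_cast; linarith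
      exact a2.trans (by exact_mod_cast a3)
    rw [Finset.mem_Icc]
    exact ⟨fun k => (abs_le.1 (hk k)).1, fun k => (abs_le.1 (hk k)).2⟩
  have hout : ∀ x, x ∉ S → ∀ t, 0 ≤ t → t ≤ T → 0 ≤ F x t := by
    intro x hx t a b
    have c1 := hS x hx
    have c2 : R ≤ nsq x := (le_max_left _ _).trans (hm.trans c1)
    have c3 : B ≤ ε * nsq x := by
      rw [hR, div_le_iff₀ hε0] at c2; linarith
    have c4 := hB t x a
    have c5 := mul_nonneg hε0.le (he t a b)
    simp only [F]; linarith
  have hx1 : x1 ∈ S := by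
    by_contra hx
    have := hout x1 hx t1 ht1 (by linarith)
    linarith
  have hmin : ∀ x, ∃ t ∈ Set.Icc 0 T, ∀ s ∈ Set.Icc 0 T, F x t ≤ F x s := by
    intro x
    obtain ⟨t, a, b⟩ := isCompact_Icc.exists_isMinOn (s := Set.Icc 0 T) ⟨0, by constructor <;> linarith⟩
      (f := F x) (fun t _ => (hF x t).continuousAt.continuousWithinAt)
    exact ⟨t, a, fun s hs => b hs⟩
  choose τ hτ hτm using hmin
  obtain ⟨x0, hx0, hx0m⟩ := Finset.exists_min_image S (fun x => F x (τ x)) ⟨x1, hx1⟩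
  set t0 := τ x0 with ht0
  have hle : F x0 t0 ≤ F x1 t1 := (hx0m x1 hx1).trans (hτm x1 t1 ⟨ht1, by linarith⟩)
  have hall : ∀ x t, t ∈ Set.Icc 0 T → F x0 t0 ≤ F x t := by
    intro x t ht
    by_cases hx : x ∈ S
    · exact (hx0m x hx).trans (hτm x t ht)
    · have := hout x hx t ht.1 ht.2
      linarith
  have ht0I := hτ x0
  have hpos : 0 < t0 := by
    rcases eq_or_lt_of_le ht0I.1 with h | h
    · exfalso
      have : 0 ≤ F x0 t0 := by
        simp only [F]
        have := mul_nonneg hε0.le (add_nonneg (hn x0) (he t0 ht0I.1 ht0I.2))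
        have h3 := h0 x0
        rw [h] at h3
        linarith
      linarith
    · exact h
  have hltT : t0 < T := by
    rcases eq_or_lt_of_le ht0I.2 with h | h
    · exfalso
      have : -δ ≤ F x0 t0 := by
        simp only [F]
        have := mul_nonneg hε0.le (add_nonneg (hn x0) (he t0 ht0I.1 ht0I.2))
        have h3 := hTT x0
        rw [← h] at h3
        linarith
      linarith
    · exact h
  have hloc : IsLocalMin (F x0) t0 := by
    filter_upwards [Icc_mem_nhds hpos hltT] with t ht
    exact hall x0 t ht
  obtain ⟨k1, k2⟩ := snd_test (hF x0) (hF1 x0 t0) hloc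
  have hlapF : 0 ≤ lap (fun x => F x t0) x0 := by
    unfold lap
    apply mul_nonneg (by norm_num)
    apply Finset.sum_nonneg
    intro k _
    have a1 := hall (x0 + Pi.single k 1) t0 ⟨hpos.le, hltT.le⟩
    have a2 := hall (x0 - Pi.single k 1) t0 ⟨hpos.le, hltT.le⟩
    linarith
  have hl2 : lap (fun x => F x t0) x0 = lap (w t0) x0 + ε * (d / 2) := by
    simp only [F]
    rw [lap_add_mul, lap_nsq]
  have h3 := heq t0 x0 hpos
  have hw1 : w1 t0 x0 = -(ε * (C * (2 * T - 2 * t0))) := by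
    simp only [F1] at k1; linarith
  have h4 : 0 ≤ β / t0 * (ε * (C * (2 * T - 2 * t0))) := by
    have : 0 ≤ 2 * T - 2 * t0 := by linarith
    positivity
  rw [hw1] at h3
  have h5 : ε * (C * (-2)) = - (ε * (d / 2)) - 2 * ε := by rw [hC]; ring
  nlinarith

end PS


namespace PS

lemma lap_comb {d : ℕ} (ε a : ℝ) (g h : (Fin d → ℤ) → ℝ) (S : Finset (Fin d → ℤ)) (c : (Fin d → ℤ) → ℝ)
    (x : Fin d → ℤ) :
    lap (fun x => ε + a * g x + ∑ y ∈ S, c y * h (x - y)) x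
      = a * lap g x + ∑ y ∈ S, c y * lap h (x - y) := by
  unfold lap
  have : ∑ y ∈ S, c y * (1 / 4 * ∑ k, (h (x - y + Pi.single k 1) + h (x - y - Pi.single k 1) - 2 * h (x - y)))
     = 1 / 4 * ∑ k, ∑ y ∈ S, c y * (h (x - y + Pi.single k 1) + h (x - y - Pi.single k 1) - 2 * h (x - y)) := by
    rw [Finset.sum_comm, Finset.mul_sum]
    refine Finset.sum_congr rfl fun y _ => ?_
    rw [Finset.mul_sum, Finset.mul_sum, Finset.mul_sum]
    exact Finset.sum_congr rfl fun k _ => by ring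
  rw [this, mul_left_comm a, ← mul_add]
  congr 1
  rw [Finset.mul_sum, ← Finset.sum_add_distrib]
  refine Finset.sum_congr rfl fun k _ => ?_
  simp only [add_sub_right_comm x, sub_right_comm x (Pi.single k 1)]
  simp only [mul_sub, mul_add, Finset.sum_add_distrib, Finset.sum_sub_distrib, Finset.mul_sum]
  simp only [mul_left_comm _ (2 : ℝ)]
  ring

lemma eta_nonneg (d : ℕ) (t : ℝ) : 0 ≤ eta d t :=
  integral_nonneg fun _ => (Real.exp_pos _).le

lemma combP {d : ℕ} (ε a : ℝ) (hε : 0 ≤ ε) (n : ℕ) (s : ℝ) (hs : 0 ≤ s) (S : Finset (Fin d → ℤ))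
    (c : (Fin d → ℤ) → ℝ)
    (h0 : ∀ x, 0 ≤ ε + a * J d n s x + ∑ y ∈ S, c y * J d 0 0 (x - y)) :
    ∀ t x, 0 ≤ t → 0 ≤ ε + a * J d n (s + t) x + ∑ y ∈ S, c y * J d 0 t (x - y) := by
  rcases Nat.eq_zero_or_pos d with rfl | hd
  · intro t x ht
    have := h0 x
    have e1 : J 0 n (s + t) x = J 0 n s x := by
      cases n with
      | zero => rw [J_dim0, J_dim0]
      | succ n => rw [J1_dim0, J1_dim0]
    simp only [J_dim0] at this ⊢
    rwa [e1]
  have hder : ∀ m t x, HasDerivAt (fun t => J d m (s + t) x) (-J d (m + 1) (s + t) x) t := by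
    intro m t x
    have := (J_hasDerivAt d m (s + t) x).comp_const_add s t
    exact this
  set A := |a| * (d : ℝ) ^ n + ∑ y ∈ S, |c y| with hA
  have hA0 : 0 ≤ A := by positivity
  have key : ∀ t x δ, 0 ≤ δ → eta d t ≤ δ → eta d (s + t) ≤ δ →
      -(A * δ) ≤ ε + a * J d n (s + t) x + ∑ y ∈ S, c y * J d 0 t (x - y) := by
    intro t x δ hδ e1 e2
    have b1 : |a * J d n (s + t) x| ≤ |a| * (d : ℝ) ^ n * δ := by
      rw [abs_mul, mul_assoc]
      refine mul_le_mul_of_nonneg_left ((abs_J_le d n _ x).trans ?_) (abs_nonneg _)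
      gcongr
    have b2 : |∑ y ∈ S, c y * J d 0 t (x - y)| ≤ (∑ y ∈ S, |c y|) * δ := by
      rw [Finset.sum_mul]
      refine (Finset.abs_sum_le_sum_abs _ _).trans (Finset.sum_le_sum fun y _ => ?_)
      rw [abs_mul]
      refine mul_le_mul_of_nonneg_left ((abs_J_le d 0 _ _).trans ?_) (abs_nonneg _)
      simpa using e1
    have b3 := neg_abs_le (a * J d n (s + t) x)
    have b4 := neg_abs_le (∑ y ∈ S, c y * J d 0 t (x - y))
    have : A * δ = |a| * (d : ℝ) ^ n * δ + (∑ y ∈ S, |c y|) * δ := by rw [hA]; ring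
    linarith
  apply minP 0 le_rfl (fun t x => ε + a * J d n (s + t) x + ∑ y ∈ S, c y * J d 0 t (x - y))
    (fun t x => a * (-J d (n + 1) (s + t) x) + ∑ y ∈ S, c y * (-J d 1 t (x - y)))
    (fun t x => a * (J d (n + 2) (s + t) x) + ∑ y ∈ S, c y * (J d 2 t (x - y)))
  · intro t x
    exact (((hder n t x).const_mul a).const_add ε).add
      (HasDerivAt.fun_sum fun y _ => (J_hasDerivAt d 0 t (x - y)).const_mul (c y))
  · intro t x
    refine HasDerivAt.add ?_ (HasDerivAt.fun_sum fun y _ => ?_)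
    · refine ((hder (n + 1) t x).neg.const_mul a).congr_deriv (by rw [neg_neg])
    · refine ((J_hasDerivAt d 1 t (x - y)).neg.const_mul (c y)).congr_deriv (by rw [neg_neg])
  · intro t x ht
    rw [lap_comb]
    simp only [J_lap]
    simp; ring
  · intro t x ht
    have := key t x 1 zero_le_one (eta_le_one d t ht) (eta_le_one d (s + t) (by linarith))
    rw [mul_one] at this
    exact this
  · intro x
    have := h0 x
    simpa using this
  · intro δ hδ
    have h1 := (eta_tendsto d hd).eventually (ge_mem_nhds (show 0 < δ / (A + 1) by positivity))
    obtain ⟨T0, hT0⟩ := Filter.eventually_atTop.1 h1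
    refine ⟨T0, fun T x hT => ?_⟩
    have := key T x (δ / (A + 1)) (by positivity) (hT0 T hT) (hT0 (s + T) (by linarith))
    refine le_trans ?_ this
    rw [neg_le_neg_iff, mul_div_assoc', div_le_iff₀ (by positivity)]
    nlinarith

lemma p_nonneg {d : ℕ} {t : ℝ} (ht : 0 ≤ t) (z : Fin d → ℤ) : 0 ≤ J d 0 t z := by
  have := combP 0 0 le_rfl 0 0 le_rfl {0} (fun _ => 1) (d := d) (fun x => by
    simp [J_zero]) t z ht
  simpa using this

lemma p_le_one {d : ℕ} {t : ℝ} (ht : 0 ≤ t) (z : Fin d → ℤ) : J d 0 t z ≤ 1 := by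
  have := (le_abs_self _).trans (abs_J_le d 0 t z)
  have h2 := eta_le_one d t ht
  simp at this
  linarith

lemma p_sum_le {d : ℕ} {t : ℝ} (ht : 0 ≤ t) (S : Finset (Fin d → ℤ)) :
    ∑ y ∈ S, J d 0 t y ≤ 1 := by
  have := combP 1 0 zero_le_one 0 0 le_rfl S (fun _ => -1) (d := d) (fun x => by
    simp only [J_zero, sub_eq_zero]
    simp
    split_ifs <;> norm_num) t 0 ht
  simp [J_symm] at this
  exact this

lemma p_summable {d : ℕ} {t : ℝ} (ht : 0 ≤ t) : Summable (J d 0 t) :=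
  summable_of_sum_le (fun z => p_nonneg ht z) (p_sum_le ht)

lemma semigroup_aux {d n : ℕ} {s t : ℝ} (hs : 0 ≤ s) (ht : 0 ≤ t) (hsum : Summable (J d n s))
    (x : Fin d → ℤ) : HasSum (fun y => J d n s y * J d 0 t (x - y)) (J d n (s + t) x) := by
  have hz := hsum.tendsto_cofinite_zero
  rw [HasSum, Metric.tendsto_nhds]
  intro ε hε
  have h1 : {y | ¬ |J d n s y| < ε / 2}.Finite := by
    have := Metric.tendsto_nhds.1 hz (ε / 2) (by positivity)
    simpa [Filter.Eventually, Filter.mem_cofinite, Set.compl_def] using this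
  simp only [SummationFilter.unconditional_filter]
  filter_upwards [Filter.eventually_ge_atTop h1.toFinset] with S hS
  have hout : ∀ y, y ∉ S → |J d n s y| ≤ ε / 2 := by
    intro y hy
    by_contra hcon
    apply hy
    apply hS
    simp only [Set.Finite.mem_toFinset, Set.mem_ofPred_eq]
    intro h; exact hcon h.le
  have hval : ∀ (r : ℝ) (x : Fin d → ℤ), ∑ y ∈ S, (r * J d n s y) * J d 0 0 (x - y)
      = if x ∈ S then r * J d n s x else 0 := by
    intro r x
    simp only [J_zero, sub_eq_zero, mul_ite, mul_one, mul_zero]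
    simp
  have A := combP (ε / 2) 1 (by positivity) n s hs S (fun y => -1 * J d n s y) (fun x => by
    rw [hval]
    split_ifs with h
    · linarith
    · linarith [neg_abs_le (J d n s x), hout x h]) t x ht
  have B := combP (ε / 2) (-1) (by positivity) n s hs S (fun y => 1 * J d n s y) (fun x => by
    rw [hval]
    split_ifs with h
    · linarith
    · linarith [le_abs_self (J d n s x), hout x h]) t x ht
  have e1 : ∑ y ∈ S, (-1 * J d n s y) * J d 0 t (x - y) = -∑ y ∈ S, J d n s y * J d 0 t (x - y) := by
    rw [← Finset.sum_neg_distrib]; exact Finset.sum_congr rfl fun _ _ => by ring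
  rw [e1] at A
  simp only [one_mul] at A B
  rw [Real.dist_eq, abs_lt]
  constructor <;> linarith

lemma q_nonneg {d : ℕ} {t : ℝ} (ht : 0 ≤ t) (z : Fin d → ℤ) : 0 ≤ J d 0 t z + t * J d 1 t z := by
  rcases Nat.eq_zero_or_pos d with rfl | hd
  · rw [J_dim0, J1_dim0]; simp
  refine minP 2 (by norm_num) (fun t z => J d 0 t z + t * J d 1 t z)
    (fun t z => -(t * J d 2 t z)) (fun t z => -(J d 2 t z - t * J d 3 t z)) ?_ ?_ ?_ 3 ?_ ?_ ?_ t z ht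
  · intro t x
    refine ((J_hasDerivAt d 0 t x).add ((hasDerivAt_id t).mul (J_hasDerivAt d 1 t x))).congr_deriv ?_
    simp
  · intro t x
    refine (((hasDerivAt_id t).mul (J_hasDerivAt d 2 t x)).neg).congr_deriv ?_
    simp; ring
  · intro t x ht
    have h := lap_add_mul (J d 0 t) (J d 1 t) t 0 x
    simp only [add_zero] at h
    rw [h, J_lap, J_lap]
    field_simp
    ring
  · intro t x ht
    have a1 := abs_J_le d 0 t x
    have a2 := abs_tJ1_le d t ht x
    have a3 := eta_le_one d t ht
    have a4 := eta_le_one d (t / 2) (by linarith)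
    have a5 := neg_abs_le (J d 0 t x)
    have a6 := neg_abs_le (t * J d 1 t x)
    simp at a1
    linarith
  · intro x
    simp; exact p_nonneg le_rfl x
  · intro δ hδ
    have h1 := (eta_tendsto d hd).eventually (ge_mem_nhds (show 0 < δ / 3 by positivity))
    obtain ⟨T0, hT0⟩ := Filter.eventually_atTop.1 h1
    refine ⟨2 * max T0 0, fun T x hT => ?_⟩
    have c1 := le_max_left T0 0
    have c2 := le_max_right T0 0
    have a1 := abs_J_le d 0 T x
    have a2 := abs_tJ1_le d T (by linarith) x
    have a3 := hT0 T (by linarith)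
    have a4 := hT0 (T / 2) (by linarith)
    have a5 := neg_abs_le (J d 0 T x)
    have a6 := neg_abs_le (T * J d 1 T x)
    simp at a1
    linarith

lemma p_le_mul {d : ℕ} {r t : ℝ} (hr : 0 < r) (hrt : r ≤ t) (z : Fin d → ℤ) :
    r * J d 0 t z ≤ t * J d 0 r z := by
  have hder : ∀ t : ℝ, 0 < t → HasDerivAt (fun t => J d 0 t z / t) ((-J d 1 t z * t - J d 0 t z * 1) / t ^ 2) t :=
    fun t ht => (J_hasDerivAt d 0 t z).div (hasDerivAt_id t) ht.ne'
  have hA : AntitoneOn (fun t => J d 0 t z / t) (Set.Ioi 0) := by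
    apply antitoneOn_of_deriv_nonpos (convex_Ioi 0)
    · exact fun t ht => (hder t ht).continuousAt.continuousWithinAt
    · rw [interior_Ioi]
      exact fun t ht => (hder t ht).differentiableAt.differentiableWithinAt
    · rw [interior_Ioi]
      intro t ht
      rw [(hder t ht).deriv]
      apply div_nonpos_of_nonpos_of_nonneg _ (sq_nonneg _)
      have := q_nonneg (le_of_lt ht) z
      linarith
  have := hA (Set.mem_Ioi.2 hr) (Set.mem_Ioi.2 (hr.trans_le hrt)) hrt
  simp only at this
  rw [div_le_div_iff₀ (hr.trans_le hrt) hr] at this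
  linarith

lemma J2_le {d : ℕ} {t : ℝ} (ht : 0 ≤ t) (z : Fin d → ℤ) : J d 2 t z ≤ d / 2 * J d 0 t z := by
  have h := J_lap d 0 t z
  have h2 : -(d / 2 * J d 0 t z) ≤ lap (J d 0 t) z := by
    unfold lap
    have : ∑ k : Fin d, (- 2 * J d 0 t z) ≤ ∑ k, (J d 0 t (z + Pi.single k 1) + J d 0 t (z - Pi.single k 1) - 2 * J d 0 t z) :=
      Finset.sum_le_sum fun k _ => by linarith [p_nonneg ht (z + Pi.single k 1), p_nonneg ht (z - Pi.single k 1)]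
    simp only [Finset.sum_const, Finset.card_univ, Fintype.card_fin, nsmul_eq_mul] at this
    linarith
  linarith

lemma abs_J1_le {d : ℕ} {t : ℝ} (ht : 0 < t) (z : Fin d → ℤ) :
    |J d 1 t z| ≤ (1 / t + d * t) * J d 0 t z := by
  have hp := p_nonneg ht.le z
  rw [abs_le]
  constructor
  · have h := q_nonneg ht.le z
    have : -(1 / t * J d 0 t z) ≤ J d 1 t z := by
      rw [one_div, ← mul_neg, inv_mul_le_iff₀ ht]; linarith
    have h2 : 0 ≤ d * t * J d 0 t z := by positivity
    linarith
  · obtain ⟨c, hc, hc1⟩ := exists_hasDerivAt_eq_slope (fun t => J d 0 t z) (fun t => -J d 1 t z)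
      (show t < 2 * t by linarith) (fun s _ => (J_hasDerivAt d 0 s z).continuousAt.continuousWithinAt)
      (fun s _ => J_hasDerivAt d 0 s z)
    obtain ⟨e, he, he1⟩ := exists_hasDerivAt_eq_slope (fun t => J d 1 t z) (fun t => -J d 2 t z)
      hc.1 (fun s _ => (J_hasDerivAt d 1 s z).continuousAt.continuousWithinAt)
      (fun s _ => J_hasDerivAt d 1 s z)
    have hct : 0 < c - t := by linarith [hc.1]
    rw [_root_.eq_div_iff (by linarith)] at hc1
    rw [_root_.eq_div_iff hct.ne'] at he1
    have h2t := p_nonneg (d := d) (show 0 ≤ 2 * t by linarith) z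
    have b1 : J d 1 c z ≤ 1 / t * J d 0 t z := by
      rw [one_div, le_inv_mul_iff₀ ht]
      have : 2 * t - t = t := by ring
      rw [this] at hc1
      linarith
    have hept : 0 < e := by linarith [he.1]
    have b2 : J d 2 e z ≤ d * J d 0 t z := by
      refine (J2_le hept.le z).trans ?_
      have := p_le_mul ht he.1.le z
      have h3 : J d 0 e z ≤ 2 * J d 0 t z := by
        have : t * J d 0 e z ≤ t * (2 * J d 0 t z) := by
          nlinarith [he.2, hc.2]
        exact le_of_mul_le_mul_left this ht
      have : (0:ℝ) ≤ d / 2 := by positivity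
      nlinarith
    have b3 : J d 2 e z * (c - t) ≤ d * J d 0 t z * t := by
      have : 0 ≤ d * J d 0 t z := by positivity
      calc _ ≤ d * J d 0 t z * (c - t) := by gcongr
        _ ≤ _ := by apply mul_le_mul_of_nonneg_left _ this; linarith [hc.2]
    nlinarith

lemma J1_summable {d : ℕ} {t : ℝ} (ht : 0 < t) : Summable (J d 1 t) :=
  Summable.of_norm_bounded ((p_summable ht.le).mul_left (1 / t + d * t)) fun z => abs_J1_le ht z

lemma semigroup0 {d : ℕ} {s t : ℝ} (hs : 0 ≤ s) (ht : 0 ≤ t)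
    (x : Fin d → ℤ) : HasSum (fun y => J d 0 s y * J d 0 t (x - y)) (J d 0 (s + t) x) :=
  semigroup_aux hs ht (p_summable hs) x

lemma semigroup1 {d : ℕ} {s t : ℝ} (hs : 0 < s) (ht : 0 ≤ t)
    (x : Fin d → ℤ) : HasSum (fun y => J d 1 s y * J d 0 t (x - y)) (J d 1 (s + t) x) :=
  semigroup_aux hs.le ht (J1_summable hs) x

lemma p_pos {d : ℕ} {t : ℝ} (ht : 0 < t) (z : Fin d → ℤ) : 0 < J d 0 t z := by
  have step : ∀ z : Fin d → ℤ, J d 0 t z = 0 → ∀ k, J d 0 t (z + Pi.single k 1) = 0 ∧ J d 0 t (z - Pi.single k 1) = 0 := by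
    intro z hz
    have hloc : IsLocalMin (fun s => J d 0 s z) t := by
      filter_upwards [lt_mem_nhds ht] with s hs
      rw [hz]; exact p_nonneg hs.le z
    obtain ⟨-, h2⟩ := snd_test (fun s => J_hasDerivAt d 0 s z) (J_hasDerivAt d 1 t z).neg hloc
    rw [neg_neg] at h2
    have h3 := J_lap d 0 t z
    unfold lap at h3
    rw [hz] at h3
    have h4 : ∑ k, (J d 0 t (z + Pi.single k 1) + J d 0 t (z - Pi.single k 1) - 2 * 0) ≤ 0 := by
      norm_num at h3 ⊢
      linarith
    have hnn : ∀ k ∈ Finset.univ, 0 ≤ (J d 0 t (z + Pi.single k 1) + J d 0 t (z - Pi.single k 1) - 2 * 0) :=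
      fun k _ => by linarith [p_nonneg ht.le (z + Pi.single k 1), p_nonneg ht.le (z - Pi.single k 1)]
    have h5 := (Finset.sum_eq_zero_iff_of_nonneg hnn).1 (le_antisymm h4 (Finset.sum_nonneg hnn))
    intro k
    have := h5 k (Finset.mem_univ k)
    constructor <;> linarith [p_nonneg ht.le (z + Pi.single k 1), p_nonneg ht.le (z - Pi.single k 1)]
  have hind : ∀ (m : ℕ) (z : Fin d → ℤ), ∑ k, (z k).natAbs = m → J d 0 t z = 0 → J d 0 t 0 = 0 := by
    intro m
    induction m using Nat.strong_induction_on with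
    | _ m ih =>
      intro z hm hz
      by_cases h : z = 0
      · rwa [h] at hz
      · obtain ⟨k, hk⟩ := Function.ne_iff.1 h
        simp only [Pi.zero_apply] at hk
        rcases lt_or_gt_of_ne hk with h1 | h1
        · refine ih _ ?_ (z + Pi.single k 1) rfl (step z hz k).1
          rw [← hm]
          apply Finset.sum_lt_sum
          · intro j _
            by_cases hj : j = k
            · subst hj; simp; omega
            · simp [Pi.single_eq_of_ne hj]
          · exact ⟨k, Finset.mem_univ k, by simp; omega⟩
        · refine ih _ ?_ (z - Pi.single k 1) rfl (step z hz k).2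
          rw [← hm]
          apply Finset.sum_lt_sum
          · intro j _
            by_cases hj : j = k
            · subst hj; simp; omega
            · simp [Pi.single_eq_of_ne hj]
          · exact ⟨k, Finset.mem_univ k, by simp; omega⟩
  refine lt_of_le_of_ne (p_nonneg ht.le z) fun h => ?_
  have h0 := hind _ z rfl h.symm
  rw [eta_pos] at h0
  have h1 : Real.exp (-t * d) * eta d 0 ≤ eta d t := by
    unfold eta
    rw [← integral_const_mul]
    have := sinNorm_cont d
    apply integral_mono (int_cube (by fun_prop)) (int_cube (by fun_prop))
    intro ξ
    simp only [neg_zero, zero_mul, Real.exp_zero, mul_one]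
    apply Real.exp_le_exp.2
    nlinarith [sinNorm_le d ξ]
  rw [eta_zero, h0] at h1
  linarith [Real.exp_pos (-t * (d : ℝ))]

end PS


namespace PS

noncomputable def U (d n : ℕ) (f : (Fin d → ℤ) → ℝ) (t : ℝ) (x : Fin d → ℤ) : ℝ :=
  ∑' y, J d n t (x - y) * f y

lemma J2_eq (d : ℕ) (t : ℝ) (z : Fin d → ℤ) : J d 2 t z = - lap (J d 0 t) z := by
  rw [J_lap]; simp

lemma p_le_dom {d : ℕ} {a b t : ℝ} (ha : 0 < a) (h1 : a < t) (h2 : t < b) (z : Fin d → ℤ) :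
    J d 0 t z ≤ b / a * J d 0 a z := by
  have := p_le_mul ha h1.le z
  have h3 : t * J d 0 a z ≤ b * J d 0 a z := mul_le_mul_of_nonneg_right h2.le (p_nonneg ha.le z)
  rw [div_mul_eq_mul_div, le_div_iff₀ ha]
  linarith

lemma dom {d : ℕ} {a b : ℝ} (ha : 0 < a) (n : ℕ) (hn : n ≤ 2) :
    ∃ D : (Fin d → ℤ) → ℝ, Summable D ∧ ∀ t, a < t → t < b → ∀ z, |J d n t z| ≤ D z := by
  have hs := p_summable (d := d) ha.le
  have shA : ∀ e : Fin d → ℤ, Summable fun z => J d 0 a (z + e) := fun e =>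
    (Equiv.summable_iff (Equiv.addRight e)).2 hs
  have shB : ∀ e : Fin d → ℤ, Summable fun z => J d 0 a (z - e) := fun e =>
    (Equiv.summable_iff (Equiv.subRight e)).2 hs
  interval_cases n
  · refine ⟨fun z => b / a * J d 0 a z, hs.mul_left _, fun t h1 h2 z => ?_⟩
    rw [abs_of_nonneg (p_nonneg (ha.trans h1).le z)]
    exact p_le_dom ha h1 h2 z
  · refine ⟨fun z => (1 / a + d * b) * (b / a * J d 0 a z), (hs.mul_left _).mul_left _, fun t h1 h2 z => ?_⟩
    have ht := ha.trans h1
    refine (abs_J1_le ht z).trans ?_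
    have hp := p_nonneg ht.le z
    have hb : 0 < b := ht.trans h2
    have e : 1 / t ≤ 1 / a := one_div_le_one_div_of_le ha h1.le
    apply mul_le_mul _ (p_le_dom ha h1 h2 z) hp (by positivity)
    gcongr
  · refine ⟨fun z => 1 / 4 * ∑ k : Fin d, (b / a * J d 0 a (z + Pi.single k 1) +
      b / a * J d 0 a (z - Pi.single k 1) + 2 * (b / a * J d 0 a z)), ?_, fun t h1 h2 z => ?_⟩
    · refine (summable_sum fun k _ => ?_).mul_left _
      refine Summable.add (Summable.add ?_ ?_) ((hs.mul_left _).mul_left _)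
      · exact (shA _).mul_left _
      · exact (shB _).mul_left _
    · have ht := ha.trans h1
      rw [J2_eq, abs_neg]
      unfold lap
      rw [abs_mul, abs_of_pos (by norm_num : (0:ℝ) < 1/4)]
      refine mul_le_mul_of_nonneg_left ((Finset.abs_sum_le_sum_abs _ _).trans
        (Finset.sum_le_sum fun k _ => ?_)) (by norm_num)
      have a1 := p_le_dom ha h1 h2 z
      have a2 := p_le_dom ha h1 h2 (z + Pi.single k 1)
      have a3 := p_le_dom ha h1 h2 (z - Pi.single k 1)
      have b1 := p_nonneg ht.le z
      have b2 := p_nonneg ht.le (z + Pi.single k 1)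
      have b3 := p_nonneg ht.le (z - Pi.single k 1)
      rw [abs_le]; constructor <;> linarith

lemma J_summable {d : ℕ} {t : ℝ} (ht : 0 < t) (n : ℕ) (hn : n ≤ 2) : Summable fun z => |J d n t z| := by
  obtain ⟨D, h1, h2⟩ := dom (d := d) (half_pos ht) (b := 2 * t) n hn
  exact Summable.of_nonneg_of_le (fun _ => abs_nonneg _) (h2 t (by linarith) (by linarith)) h1

lemma sub_inj {d : ℕ} (x : Fin d → ℤ) : Function.Injective fun y : Fin d → ℤ => x - y :=
  sub_right_injective

lemma U_summable {d : ℕ} {t : ℝ} (ht : 0 < t) (n : ℕ) (hn : n ≤ 2) {f : (Fin d → ℤ) → ℝ} {B : ℝ}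
    (hB : ∀ y, |f y| ≤ B) (x : Fin d → ℤ) : Summable fun y => J d n t (x - y) * f y := by
  refine Summable.of_norm_bounded (((J_summable ht n hn).comp_injective (sub_inj x)).mul_right B)
    fun y => ?_
  rw [Real.norm_eq_abs, abs_mul]
  exact mul_le_mul_of_nonneg_left (hB y) (abs_nonneg _)

lemma U_hasDerivAt {d : ℕ} {t : ℝ} (ht : 0 < t) (n : ℕ) (hn : n ≤ 1) {f : (Fin d → ℤ) → ℝ} {B : ℝ}
    (hB : ∀ y, |f y| ≤ B) (x : Fin d → ℤ) :
    HasDerivAt (fun t => U d n f t x) (-U d (n + 1) f t x) t := by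
  obtain ⟨D, h1, h2⟩ := dom (d := d) (half_pos ht) (b := 2 * t) (n + 1) (by omega)
  have hB0 : 0 ≤ B := (abs_nonneg _).trans (hB 0)
  have := hasDerivAt_tsum_of_isPreconnected (u := fun y => D (x - y) * B)
    (g := fun y t => J d n t (x - y) * f y) (g' := fun y t => -J d (n + 1) t (x - y) * f y)
    (t := Set.Ioo (t / 2) (2 * t)) (y₀ := t) (y := t)
    ((h1.comp_injective (sub_inj x)).mul_right B) isOpen_Ioo isPreconnected_Ioo
    (fun y s _ => (J_hasDerivAt d n s (x - y)).mul_const (f y))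
    (fun y s hs => by
      rw [Real.norm_eq_abs, abs_mul, abs_neg]
      exact mul_le_mul (h2 s hs.1 hs.2 _) (hB y) (abs_nonneg _) ((abs_nonneg _).trans (h2 s hs.1 hs.2 _)))
    ⟨by linarith, by linarith⟩ (U_summable ht n (by omega) hB x) ⟨by linarith, by linarith⟩
  refine this.congr_deriv ?_
  unfold U
  rw [← tsum_neg]
  simp

lemma U_lap {d : ℕ} {t : ℝ} (ht : 0 < t) {f : (Fin d → ℤ) → ℝ} {B : ℝ}
    (hB : ∀ y, |f y| ≤ B) (x : Fin d → ℤ) : lap (U d 0 f t) x = - U d 2 f t x := by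
  unfold U
  have hs := U_summable ht 0 (by norm_num) hB
  rw [← tsum_neg]
  have e : ∀ y, -(J d 2 t (x - y) * f y) = 1 / 4 * ∑ k : Fin d,
      (J d 0 t (x + Pi.single k 1 - y) * f y + J d 0 t (x - Pi.single k 1 - y) * f y - 2 * (J d 0 t (x - y) * f y)) := by
    intro y
    rw [J2_eq]
    unfold lap
    rw [neg_mul, neg_neg, mul_assoc, Finset.sum_mul]
    congr 1
    refine Finset.sum_congr rfl fun k _ => ?_
    rw [add_sub_right_comm x, sub_right_comm x (Pi.single k 1)]
    ring
  simp_rw [e]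
  rw [tsum_mul_left, Summable.tsum_finsetSum]
  · unfold lap
    congr 1
    refine Finset.sum_congr rfl fun k _ => ?_
    rw [Summable.tsum_sub ((hs _).add (hs _)) ((hs _).mul_left 2), Summable.tsum_add (hs _) (hs _), tsum_mul_left]
  · exact fun k _ => ((hs _).add (hs _)).sub ((hs _).mul_left 2)

lemma U_nonneg {d : ℕ} {t : ℝ} (ht : 0 ≤ t) {f : (Fin d → ℤ) → ℝ} (hf : ∀ y, 0 ≤ f y) (x : Fin d → ℤ) :
    0 ≤ U d 0 f t x := tsum_nonneg fun y => mul_nonneg (p_nonneg ht _) (hf y)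

lemma U_pos {d : ℕ} {t : ℝ} (ht : 0 < t) {f : (Fin d → ℤ) → ℝ} {B : ℝ}
    (hB : ∀ y, |f y| ≤ B) (hf : ∀ y, 0 ≤ f y) (y : Fin d → ℤ) (hy : f y ≠ 0) (x : Fin d → ℤ) :
    0 < U d 0 f t x :=
  (U_summable ht 0 (by norm_num) hB x).tsum_pos (fun y => mul_nonneg (p_nonneg ht.le _) (hf y)) y
    (mul_pos (p_pos ht _) (lt_of_le_of_ne (hf y) hy.symm))

lemma U_semigroup {d : ℕ} {s t : ℝ} (hs : 0 < s) (ht : 0 < t) (n : ℕ) (hn : n ≤ 1) {f : (Fin d → ℤ) → ℝ} {B : ℝ}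
    (hB : ∀ y, |f y| ≤ B) (x : Fin d → ℤ) :
    HasSum (fun y => J d 0 t (x - y) * U d n f s y) (U d n f (s + t) x) := by
  have hB0 : 0 ≤ B := (abs_nonneg _).trans (hB 0)
  have hS : Summable fun q : (Fin d → ℤ) × (Fin d → ℤ) => J d 0 t (x - q.1) * (J d n s (q.1 - q.2) * f q.2) := by
    have h1 := (J_summable (d := d) ht 0 (by norm_num)).mul_of_nonneg (J_summable (d := d) hs n (by omega))
      (fun _ => abs_nonneg _) (fun _ => abs_nonneg _)
    have hinj : Function.Injective fun q : (Fin d → ℤ) × (Fin d → ℤ) => (x - q.1, q.1 - q.2) := by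
      rintro ⟨a, b⟩ ⟨a', b'⟩ h
      simp only [Prod.mk.injEq] at h
      obtain ⟨h1, h2⟩ := h
      have h1 := sub_right_injective h1
      subst h1
      have := sub_right_injective h2
      subst this; rfl
    refine Summable.of_norm_bounded ((h1.comp_injective hinj).mul_right B) fun q => ?_
    simp only [Function.comp, Real.norm_eq_abs, abs_mul]
    rw [← mul_assoc]
    exact mul_le_mul_of_nonneg_left (hB _) (by positivity)
  have h2 : U d n f (s + t) x = ∑' z, ∑' y, J d 0 t (x - y) * (J d n s (y - z) * f z) := by
    unfold U
    refine tsum_congr fun z => ?_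
    have h3 : HasSum (fun y => J d n s y * J d 0 t ((x - z) - y)) (J d n (s + t) (x - z)) := by
      interval_cases n
      · exact semigroup0 hs.le ht.le _
      · exact semigroup1 hs ht.le _
    rw [← (h3.mul_right (f z)).tsum_eq, ← (Equiv.subRight z).tsum_eq]
    refine tsum_congr fun y => ?_
    simp only [Equiv.subRight_apply, sub_sub_sub_cancel_right]
    ring
  have h6 : ∑' z, ∑' y, J d 0 t (x - y) * (J d n s (y - z) * f z)
      = ∑' y, ∑' z, J d 0 t (x - y) * (J d n s (y - z) * f z) :=
    Summable.tsum_comm (f := fun y z => J d 0 t (x - y) * (J d n s (y - z) * f z)) hS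
  rw [h2, h6]
  have h4 : ∀ y, ∑' z, J d 0 t (x - y) * (J d n s (y - z) * f z) = J d 0 t (x - y) * U d n f s y := by
    intro y; rw [tsum_mul_left]; rfl
  simp_rw [h4]
  have h5 := hS.prod
  simp only [h4] at h5
  exact h5.hasSum

end PS


namespace PS

section hopf
variable {ι : Type*} (T : (ι → ℝ≥0∞) → (ι → ℝ≥0∞))

noncomputable def Ssum (f : ι → ℝ≥0∞) : ℕ → ι → ℝ≥0∞
  | 0 => 0
  | k + 1 => f + T (Ssum f k)

noncomputable def Mh (f g : ι → ℝ≥0∞) : ℕ → ι → ℝ≥0∞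
  | 0 => 0
  | k + 1 => (f + T (Mh f g k)) - g

variable (hadd : ∀ f g, T (f + g) = T f + T g) (hmono : Monotone T)
  (hc : ∀ c : ℝ≥0∞, T (fun _ => c) ≤ fun _ => c) (hsum : ∀ f, ∑' x, T f x ≤ ∑' x, f x)

include hadd hmono in
lemma hopf1 (f g : ι → ℝ≥0∞) : ∀ n k, k ≤ n → Ssum T f k ≤ Mh T f g n + Ssum T g k := by
  intro n
  induction n with
  | zero => intro k hk; obtain rfl : k = 0 := by omega
            simp [Ssum]
  | succ n ih =>
    intro k hk
    cases k with
    | zero => simp [Ssum]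
    | succ k =>
      have h1 := hmono (ih k (by omega))
      rw [hadd] at h1
      have h2 : f + T (Mh T f g n) ≤ Mh T f g (n + 1) + g := le_tsub_add
      calc Ssum T f (k + 1) = f + T (Ssum T f k) := rfl
        _ ≤ f + (T (Mh T f g n) + T (Ssum T g k)) := by gcongr
        _ = (f + T (Mh T f g n)) + T (Ssum T g k) := by rw [add_assoc]
        _ ≤ (Mh T f g (n + 1) + g) + T (Ssum T g k) := by gcongr
        _ = Mh T f g (n + 1) + Ssum T g (k + 1) := by rw [add_assoc]; rfl

include hmono in
lemma hopf2 (f g : ι → ℝ≥0∞) : ∀ n, Mh T f g n ≤ Mh T f g (n + 1) := by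
  intro n
  induction n with
  | zero => intro x; simp [Mh]
  | succ n ih =>
    exact tsub_le_tsub_right (add_le_add_right (hmono ih) f) g

include hsum in
lemma hopf3 (f g : ι → ℝ≥0∞) (hf : ∑' x, f x ≠ ∞) : ∀ n, ∑' x, Mh T f g n x ≠ ∞ := by
  intro n
  induction n with
  | zero => simp [Mh]
  | succ n ih =>
    refine ne_top_of_le_ne_top (ENNReal.add_ne_top.2 ⟨hf, ih⟩) ?_
    calc ∑' x, Mh T f g (n + 1) x ≤ ∑' x, (f x + T (Mh T f g n) x) :=
          ENNReal.tsum_le_tsum fun x => tsub_le_self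
      _ = ∑' x, f x + ∑' x, T (Mh T f g n) x := ENNReal.tsum_add
      _ ≤ _ := add_le_add_right (hsum _) _

open Classical in
include hmono hsum in
lemma hopf4 (f g : ι → ℝ≥0∞) (hf : ∑' x, f x ≠ ∞) (n : ℕ) :
    ∑' x, (if 0 < Mh T f g (n + 1) x then g x else 0) ≤ ∑' x, f x := by
  have h3 := hopf3 T hsum f g hf (n + 1)
  refine (ENNReal.add_le_add_iff_left h3).1 ?_
  rw [← ENNReal.tsum_add]
  calc ∑' x, (Mh T f g (n + 1) x + if 0 < Mh T f g (n + 1) x then g x else 0)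
      ≤ ∑' x, (f x + T (Mh T f g n) x) := by
        refine ENNReal.tsum_le_tsum fun x => ?_
        split_ifs with h
        · have : g x ≤ f x + T (Mh T f g n) x := (tsub_pos_iff_lt.1 h).le
          exact (tsub_add_cancel_of_le this).le
        · rw [add_zero]; exact tsub_le_self
    _ = ∑' x, f x + ∑' x, T (Mh T f g n) x := ENNReal.tsum_add
    _ ≤ ∑' x, f x + ∑' x, Mh T f g (n + 1) x := by
        exact add_le_add_right ((hsum _).trans (ENNReal.tsum_le_tsum (hopf2 T hmono f g n))) _
    _ = _ := add_comm _ _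

include hmono hc in
lemma Ssum_le (g : ι → ℝ≥0∞) (l : ℝ≥0∞) (hg : ∀ x, g x ≤ l) : ∀ (k : ℕ) x, Ssum T g k x ≤ k * l := by
  intro k
  induction k with
  | zero => simp [Ssum]
  | succ k ih =>
    intro x
    have h1 : T (Ssum T g k) x ≤ k * l := (hmono ih x).trans (hc _ x)
    calc _ ≤ l + k * l := add_le_add (hg x) h1
      _ = _ := by push_cast; ring

include hadd in
lemma Ssum_add (f g : ι → ℝ≥0∞) : ∀ k, Ssum T (f + g) k = Ssum T f k + Ssum T g k := by
  intro k
  induction k with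
  | zero => simp [Ssum]
  | succ k ih => simp only [Ssum]; rw [ih, hadd]; abel

include hmono in
lemma Ssum_mono {f g : ι → ℝ≥0∞} (h : f ≤ g) : ∀ k, Ssum T f k ≤ Ssum T g k := by
  intro k
  induction k with
  | zero => simp [Ssum]
  | succ k ih => exact add_le_add h (hmono ih)

open Classical in
include hmono hadd hsum hc in
lemma weak1 (f : ι → ℝ≥0∞) (l : ℝ≥0∞) (hl : l ≠ ∞) (N : ℕ) :
    ∑' x, (if ∃ k : ℕ, 1 ≤ k ∧ k ≤ N ∧ k * l < Ssum T f k x then l else 0) ≤ ∑' x, f x := by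
  by_cases hf : ∑' x, f x = ∞
  · rw [hf]; exact le_top
  set g : ι → ℝ≥0∞ := fun x => (if ∃ k : ℕ, 1 ≤ k ∧ k ≤ N ∧ k * l < Ssum T f k x then l else 0) with hg
  have hgl : ∀ x, g x ≤ l := fun x => by simp only [hg]; split_ifs <;> simp
  refine le_trans (ENNReal.tsum_le_tsum fun x => ?_) (hopf4 T hmono hsum f g hf N)
  by_cases h : ∃ k : ℕ, 1 ≤ k ∧ k ≤ N ∧ k * l < Ssum T f k x
  · obtain ⟨k, h1, h2, h3⟩ := h
    have h4 := hopf1 T hadd hmono f g (N + 1) k (by omega) x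
    have h5 := Ssum_le T hmono hc g l hgl k x
    have h6 : 0 < Mh T f g (N + 1) x := by
      rw [pos_iff_ne_zero]
      intro h0
      have h4 : Ssum T f k x ≤ Mh T f g (N+1) x + Ssum T g k x := h4
      rw [h0, zero_add] at h4
      exact absurd (h3.trans_le (h4.trans h5)) (lt_irrefl _)
    rw [if_pos h6]
  · have : g x = 0 := by simp only [hg]; rw [if_neg h]
    rw [show (if ∃ k : ℕ, 1 ≤ k ∧ k ≤ N ∧ k * l < Ssum T f k x then l else 0) = g x from rfl, this]
    simp

open Classical in
include hmono hadd hsum hc in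
lemma weak2 (f : ι → ℝ≥0∞) (l : ℝ≥0∞) (hl : l ≠ ∞) (N : ℕ) :
    ∑' x, (if ∃ k : ℕ, 1 ≤ k ∧ k ≤ N ∧ k * (2 * l) < Ssum T f k x then l else 0)
      ≤ ∑' x, if l < f x then f x else 0 := by
  set f1 : ι → ℝ≥0∞ := fun x => if l < f x then f x else 0 with hf1
  refine le_trans (ENNReal.tsum_le_tsum fun x => ?_) (weak1 T hadd hmono hc hsum f1 l hl N)
  split_ifs with h1 h2 h2
  · exact le_rfl
  · exfalso
    apply h2
    obtain ⟨k, a1, a2, a3⟩ := h1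
    refine ⟨k, a1, a2, ?_⟩
    have b1 : f ≤ f1 + fun _ => l := by
      intro x
      simp only [hf1, Pi.add_apply]
      split_ifs with h
      · exact le_self_add
      · simpa using h
    have b2 := Ssum_mono T hmono b1 k x
    rw [Ssum_add T hadd] at b2
    have b3 := Ssum_le T hmono hc (fun _ => l) l (fun _ => le_rfl) k x
    have b4 : k * l + k * l < Ssum T f1 k x + k * l := by
      calc k * l + k * l = k * (2 * l) := by ring
        _ < _ := a3
        _ ≤ _ := b2.trans (add_le_add_right b3 _)
    exact lt_of_add_lt_add_right b4
  · exact zero_le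
  · exact le_rfl

lemma layer (a : ℝ≥0∞) (ha : a ≠ ∞) (p : ℝ) (hp : 0 < p) :
    a ^ p = ENNReal.ofReal p * ∫⁻ t in Set.Ioi (0:ℝ),
      (if ENNReal.ofReal t < a then ENNReal.ofReal (t ^ (p - 1)) else 0) := by
  have h := lintegral_rpow_eq_lintegral_meas_lt_mul (Measure.dirac ()) (f := fun _ => a.toReal)
    (Filter.Eventually.of_forall fun _ => ENNReal.toReal_nonneg) aemeasurable_const hp
  rw [lintegral_dirac, ← ENNReal.ofReal_rpow_of_nonneg ENNReal.toReal_nonneg hp.le, ENNReal.ofReal_toReal ha] at h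
  rw [h]
  congr 1
  refine setLIntegral_congr_fun measurableSet_Ioi fun t ht => ?_
  simp only [ENNReal.ofReal_lt_iff_lt_toReal (le_of_lt ht) ha]
  split_ifs with h1
  · simp [h1]
  · simp [h1]

include hmono hadd hsum hc in
lemma maxN [Countable ι] (p : ℝ) (hp : 1 < p) (f : ι → ℝ≥0∞) (B : ℝ≥0∞) (hB : B ≠ ∞)
    (hf : ∀ x, f x ≤ B) (N : ℕ) (W : ι → ℝ≥0∞)
    (hW : ∀ x l, l < W x → ∃ k : ℕ, 1 ≤ k ∧ k ≤ N ∧ k * l < Ssum T f k x) (hWt : ∀ x, W x ≠ ∞) :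
    ∑' x, W x ^ p ≤ ENNReal.ofReal (2 ^ p * (p / (p - 1))) * ∑' x, f x ^ p := by
  classical
  have hp0 : 0 < p := by linarith
  have hfin : ∀ x, f x ≠ ∞ := fun x => ne_top_of_le_ne_top hB (hf x)
  have hm : ∀ (a : ℝ≥0∞) (q : ℝ), Measurable fun t : ℝ =>
      (if ENNReal.ofReal t < a then ENNReal.ofReal (t ^ q) else 0) := by
    intro a q
    refine Measurable.ite (measurableSet_lt ENNReal.measurable_ofReal measurable_const) (by fun_prop) measurable_const
  have e1 : ∀ x, W x ^ p = ENNReal.ofReal (2 ^ p) * (W x / 2) ^ p := by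
    intro x
    rw [← ENNReal.ofReal_rpow_of_nonneg (by norm_num) hp0.le, ← ENNReal.mul_rpow_of_nonneg _ _ hp0.le]
    congr 1
    rw [show ENNReal.ofReal 2 = 2 by norm_num, ENNReal.mul_div_cancel (by norm_num) (by norm_num)]
  have e2 : ∀ x, (W x / 2) ^ p = ENNReal.ofReal p * ∫⁻ t in Set.Ioi (0:ℝ),
      (if ENNReal.ofReal t < W x / 2 then ENNReal.ofReal (t ^ (p - 1)) else 0) := fun x =>
    layer _ (ENNReal.div_ne_top (hWt x) (by norm_num)) p hp0
  have e3 : ∀ x, ENNReal.ofReal (1 / (p - 1)) * f x ^ p = f x * ∫⁻ t in Set.Ioi (0:ℝ),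
      (if ENNReal.ofReal t < f x then ENNReal.ofReal (t ^ (p - 1 - 1)) else 0) := by
    intro x
    have h := layer (f x) (hfin x) (p - 1) (by linarith)
    have h2 : f x ^ p = f x * f x ^ (p - 1) := by
      by_cases h0 : f x = 0
      · rw [h0, ENNReal.zero_rpow_of_pos hp0]; simp
      · nth_rewrite 2 [← ENNReal.rpow_one (f x)]
        rw [← ENNReal.rpow_add _ _ h0 (hfin x)]; congr 1; ring
    rw [h2, h, mul_left_comm, ← mul_assoc (ENNReal.ofReal (1 / (p - 1))), ← ENNReal.ofReal_mul (by
      apply one_div_nonneg.2; linarith), one_div_mul_cancel (by linarith), ENNReal.ofReal_one, one_mul]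
  calc ∑' x, W x ^ p = ENNReal.ofReal (2 ^ p) * (ENNReal.ofReal p * ∑' x, ∫⁻ t in Set.Ioi (0:ℝ),
      (if ENNReal.ofReal t < W x / 2 then ENNReal.ofReal (t ^ (p - 1)) else 0)) := by
        simp_rw [e1, e2, ENNReal.tsum_mul_left]
    _ = ENNReal.ofReal (2 ^ p) * (ENNReal.ofReal p * ∫⁻ t in Set.Ioi (0:ℝ), ∑' x, 
      (if ENNReal.ofReal t < W x / 2 then ENNReal.ofReal (t ^ (p - 1)) else 0)) := by
        rw [lintegral_tsum fun x => (hm _ _).aemeasurable]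
    _ ≤ ENNReal.ofReal (2 ^ p) * (ENNReal.ofReal p * ∫⁻ t in Set.Ioi (0:ℝ), ∑' x, 
      f x * (if ENNReal.ofReal t < f x then ENNReal.ofReal (t ^ (p - 1 - 1)) else 0)) := by
        gcongr _ * (_ * ?_)
        refine setLIntegral_mono' measurableSet_Ioi fun t ht => ?_
        have ht0 : (0:ℝ) < t := ht
        have hw := weak2 T hadd hmono hc hsum f (ENNReal.ofReal t) ENNReal.ofReal_ne_top N
        calc _ ≤ ∑' x, ENNReal.ofReal (t ^ (p - 1 - 1)) *
            (if ∃ k : ℕ, 1 ≤ k ∧ k ≤ N ∧ k * (2 * ENNReal.ofReal t) < Ssum T f k x then ENNReal.ofReal t else 0) := by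
              refine ENNReal.tsum_le_tsum fun x => ?_
              split_ifs with h1 h2 h2
              · rw [← ENNReal.ofReal_mul (by positivity)]
                nth_rewrite 3 [← Real.rpow_one t]
                rw [← Real.rpow_add ht0]; simp
              · exfalso; apply h2
                apply hW
                rw [ENNReal.lt_div_iff_mul_lt (by norm_num) (by norm_num)] at h1
                rwa [mul_comm]
              · exact zero_le
              · exact zero_le
          _ ≤ ENNReal.ofReal (t ^ (p - 1 - 1)) * ∑' x, (if ENNReal.ofReal t < f x then f x else 0) := by
              rw [ENNReal.tsum_mul_left]; gcongr
          _ = _ := by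
              rw [← ENNReal.tsum_mul_left]
              refine tsum_congr fun x => ?_
              split_ifs
              · exact mul_comm _ _
              · simp
    _ = ENNReal.ofReal (2 ^ p) * (ENNReal.ofReal p * ∑' x, ∫⁻ t in Set.Ioi (0:ℝ),
      f x * (if ENNReal.ofReal t < f x then ENNReal.ofReal (t ^ (p - 1 - 1)) else 0)) := by
        rw [lintegral_tsum fun x => ((hm _ _).const_mul _).aemeasurable]
    _ = ENNReal.ofReal (2 ^ p) * (ENNReal.ofReal p * ∑' x, ENNReal.ofReal (1 / (p - 1)) * f x ^ p) := by
        simp_rw [e3]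
        congr 3
        funext x
        rw [lintegral_const_mul _ (hm _ _)]
    _ = _ := by
        rw [ENNReal.tsum_mul_left, ← mul_assoc, ← mul_assoc, ← ENNReal.ofReal_mul (by positivity),
          ← ENNReal.ofReal_mul (by positivity)]
        congr 2
        ring

end hopf
end PS


namespace PS

noncomputable def PE (d : ℕ) (t : ℝ) (f : (Fin d → ℤ) → ℝ≥0∞) (x : Fin d → ℤ) : ℝ≥0∞ :=
  ∑' y, ENNReal.ofReal (J d 0 t (x - y)) * f y

lemma ker_sum_le {d : ℕ} {t : ℝ} (ht : 0 ≤ t) : ∑' z, ENNReal.ofReal (J d 0 t z) ≤ 1 := by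
  rw [← ENNReal.ofReal_tsum_of_nonneg (fun z => p_nonneg ht z) (p_summable ht)]
  rw [ENNReal.ofReal_le_one]
  exact (p_summable ht).tsum_le_of_sum_le (p_sum_le ht)

lemma ker_sum_le' {d : ℕ} {t : ℝ} (ht : 0 ≤ t) (x : Fin d → ℤ) : ∑' y, ENNReal.ofReal (J d 0 t (x - y)) ≤ 1 := by
  have := (Equiv.subLeft x).tsum_eq (fun z => ENNReal.ofReal (J d 0 t z))
  simp only [Equiv.subLeft_apply] at this
  rw [this]
  exact ker_sum_le ht

lemma ker_sum_le'' {d : ℕ} {t : ℝ} (ht : 0 ≤ t) (y : Fin d → ℤ) : ∑' x, ENNReal.ofReal (J d 0 t (x - y)) ≤ 1 := by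
  have := (Equiv.subRight y).tsum_eq (fun z => ENNReal.ofReal (J d 0 t z))
  simp only [Equiv.subRight_apply] at this
  rw [this]
  exact ker_sum_le ht

lemma PE_add {d : ℕ} (t : ℝ) (f g : (Fin d → ℤ) → ℝ≥0∞) : PE d t (f + g) = PE d t f + PE d t g := by
  funext x
  simp only [PE, Pi.add_apply, mul_add, ENNReal.tsum_add]

lemma PE_mono {d : ℕ} (t : ℝ) : Monotone (PE d t) := fun _ _ h _ =>
  ENNReal.tsum_le_tsum fun y => mul_le_mul_right (h y) _

lemma PE_const {d : ℕ} {t : ℝ} (ht : 0 ≤ t) (c : ℝ≥0∞) : PE d t (fun _ => c) ≤ fun _ => c := by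
  intro x
  simp only [PE, ENNReal.tsum_mul_right]
  exact (mul_le_mul_left (ker_sum_le' ht x) c).trans (one_mul c).le

lemma PE_sum {d : ℕ} {t : ℝ} (ht : 0 ≤ t) (f : (Fin d → ℤ) → ℝ≥0∞) : ∑' x, PE d t f x ≤ ∑' x, f x := by
  simp only [PE]
  rw [ENNReal.tsum_comm]
  refine ENNReal.tsum_le_tsum fun y => ?_
  rw [ENNReal.tsum_mul_right]
  exact (mul_le_mul_left (ker_sum_le'' ht y) _).trans (one_mul _).le

/-- symmetry -/
lemma PE_symm {d : ℕ} (t : ℝ) (f g : (Fin d → ℤ) → ℝ≥0∞) :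
    ∑' x, g x * PE d t f x = ∑' x, PE d t g x * f x := by
  simp only [PE, ← ENNReal.tsum_mul_left, ← ENNReal.tsum_mul_right]
  rw [ENNReal.tsum_comm]
  refine tsum_congr fun x => tsum_congr fun y => ?_
  rw [← J_symm, neg_sub]
  ring

lemma PE_zero {d : ℕ} (f : (Fin d → ℤ) → ℝ≥0∞) : PE d 0 f = f := by
  funext x
  simp only [PE, J_zero, sub_eq_zero]
  rw [tsum_eq_single x]
  · simp
  · intro y hy; rw [if_neg (fun h => hy h.symm)]; simp

lemma PE_semigroup {d : ℕ} {s t : ℝ} (hs : 0 ≤ s) (ht : 0 ≤ t) (f : (Fin d → ℤ) → ℝ≥0∞) :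
    PE d t (PE d s f) = PE d (s + t) f := by
  funext x
  simp only [PE, ← ENNReal.tsum_mul_left]
  rw [ENNReal.tsum_comm]
  refine tsum_congr fun z => ?_
  have h := semigroup0 (d := d) hs ht (x - z)
  rw [← h.tsum_eq, ENNReal.ofReal_tsum_of_nonneg (fun y => mul_nonneg (p_nonneg hs _) (p_nonneg ht _)) h.summable,
    ← ENNReal.tsum_mul_right, ← (Equiv.subRight z).tsum_eq (fun y => ENNReal.ofReal (J d 0 s y * J d 0 t (x - z - y)) * f z)]
  refine tsum_congr fun y => ?_
  simp only [Equiv.subRight_apply, sub_sub_sub_cancel_right]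
  rw [ENNReal.ofReal_mul (p_nonneg hs _)]
  ring

lemma PE_finsum {d : ℕ} {ι : Type*} (t : ℝ) (s : Finset ι) (f : ι → (Fin d → ℤ) → ℝ≥0∞) :
    PE d t (∑ i ∈ s, f i) = ∑ i ∈ s, PE d t (f i) := by
  classical
  induction s using Finset.induction_on with
  | empty => funext x; simp [PE]
  | insert a s ha ih => rw [Finset.sum_insert ha, Finset.sum_insert ha, PE_add, ih]

lemma Ssum_PE {d : ℕ} {δ : ℝ} (hδ : 0 ≤ δ) (f : (Fin d → ℤ) → ℝ≥0∞) :
    ∀ n, Ssum (PE d δ) f n = ∑ k ∈ Finset.range n, PE d (k * δ) f := by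
  intro n
  induction n with
  | zero => simp [Ssum]
  | succ n ih =>
    rw [Ssum, ih, PE_finsum, Finset.sum_range_succ', add_comm]
    congr 1
    · refine Finset.sum_congr rfl fun k _ => ?_
      rw [PE_semigroup (by positivity) hδ]
      congr 1; push_cast; ring
    · simp [PE_zero]

lemma PE_le_mul {d : ℕ} {r t : ℝ} (hr : 0 < r) (hrt : r ≤ t) (f : (Fin d → ℤ) → ℝ≥0∞) (x : Fin d → ℤ) :
    ENNReal.ofReal r * PE d t f x ≤ ENNReal.ofReal t * PE d r f x := by
  simp only [PE, ← ENNReal.tsum_mul_left]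
  refine ENNReal.tsum_le_tsum fun y => ?_
  rw [← mul_assoc, ← mul_assoc, ← ENNReal.ofReal_mul hr.le, ← ENNReal.ofReal_mul (hr.le.trans hrt)]
  exact mul_le_mul_left (ENNReal.ofReal_le_ofReal (p_le_mul hr hrt _)) _

lemma PE_le_avg {d : ℕ} {δ t : ℝ} (hδ : 0 < δ) (n : ℕ) (hn : 1 ≤ n) (h1 : n * δ ≤ t) (h2 : t ≤ (n + 1) * δ)
    (f : (Fin d → ℤ) → ℝ≥0∞) (x : Fin d → ℤ) :
    n * PE d t f x ≤ 2 * Ssum (PE d δ) f (n + 1) x := by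
  have hk : ∀ k : ℕ, k ∈ Finset.range (n + 1) → (k : ℝ≥0∞) * PE d t f x ≤ (n + 1 : ℕ) * PE d (k * δ) f x := by
    intro k hk
    rcases Nat.eq_zero_or_pos k with rfl | hk0
    · simp
    have hk0' : (0:ℝ) < k := by exact_mod_cast hk0
    have hkn : (k : ℝ) ≤ n := by
      have := Finset.mem_range.1 hk
      exact_mod_cast (by omega : k ≤ n)
    have h := PE_le_mul (d := d) (r := k * δ) (t := t) (by positivity) (by nlinarith) f x
    have h3 : ENNReal.ofReal δ * (k * PE d t f x) ≤ ENNReal.ofReal δ * ((n + 1 : ℕ) * PE d (k * δ) f x) := by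
      calc _ = ENNReal.ofReal (k * δ) * PE d t f x := by
            rw [ENNReal.ofReal_mul hk0'.le, ENNReal.ofReal_natCast]; ring
        _ ≤ _ := h
        _ ≤ ENNReal.ofReal (((n + 1 : ℕ) : ℝ) * δ) * PE d (k * δ) f x := by
            gcongr; push_cast; exact h2
        _ = _ := by rw [ENNReal.ofReal_mul (by positivity), ENNReal.ofReal_natCast]; ring
    exact (ENNReal.mul_le_mul_iff_right (by simpa using hδ) ENNReal.ofReal_ne_top).1 h3
  have hs := Finset.sum_le_sum hk
  rw [← Finset.sum_mul, ← Finset.mul_sum, ← Nat.cast_sum] at hs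
  have hg : 2 * (∑ k ∈ Finset.range (n + 1), k) = (n + 1) * n := by
    have := Finset.sum_range_id_mul_two (n + 1)
    simp at this; linarith
  have h5 : ((n + 1 : ℕ) : ℝ≥0∞) * (n * PE d t f x) ≤ ((n + 1 : ℕ) : ℝ≥0∞) * (2 * Ssum (PE d δ) f (n + 1) x) := by
    calc _ = (((n + 1) * n : ℕ) : ℝ≥0∞) * PE d t f x := by push_cast; ring
      _ = 2 * (((∑ k ∈ Finset.range (n + 1), k : ℕ) : ℝ≥0∞) * PE d t f x) := by rw [← hg]; push_cast; ring
      _ ≤ 2 * (((n + 1 : ℕ) : ℝ≥0∞) * ∑ k ∈ Finset.range (n + 1), PE d (k * δ) f x) := by gcongr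
      _ = _ := by rw [Ssum_PE hδ.le, Finset.sum_apply]; ring
  exact (ENNReal.mul_le_mul_iff_right (by simp) (ENNReal.natCast_ne_top _)).1 h5

lemma max_fin {d : ℕ} (p : ℝ) (hp : 1 < p) (f : (Fin d → ℤ) → ℝ≥0∞) (B : ℝ≥0∞) (hB : B ≠ ∞)
    (hf : ∀ x, f x ≤ B) (m : ℕ) :
    ∑' x, (⨆ t : {t : ℝ // 1 / ((m : ℝ) + 1) ≤ t ∧ t ≤ m + 1}, PE d t f x) ^ p
      ≤ ENNReal.ofReal (8 ^ p * (p / (p - 1))) * ∑' x, f x ^ p := by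
  set δ : ℝ := 1 / ((m : ℝ) + 1) with hδ
  have hδ0 : 0 < δ := by positivity
  set N : ℕ := (m + 1) * (m + 1) + 1 with hN
  set W : (Fin d → ℤ) → ℝ≥0∞ := fun x => (Finset.Icc 1 N).sup fun k => Ssum (PE d δ) f k x / k with hWd
  have hSle := Ssum_le (PE d δ) (PE_mono δ) (PE_const hδ0.le) f B hf
  have hWB : ∀ x, W x ≤ B := by
    intro x
    refine Finset.sup_le fun k hk => ?_
    refine ENNReal.div_le_of_le_mul ?_
    rw [mul_comm]; exact hSle k x
  have hmax := maxN (PE d δ) (PE_add δ) (PE_mono δ) (PE_const hδ0.le) (PE_sum hδ0.le) p hp f B hB hf N W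
    (by
      intro x l hl
      obtain ⟨k, hk, hk2⟩ := Finset.lt_sup_iff.1 hl
      rw [Finset.mem_Icc] at hk
      refine ⟨k, hk.1, hk.2, ?_⟩
      rw [ENNReal.lt_div_iff_mul_lt (by simp; omega) (by simp)] at hk2
      rwa [mul_comm]) (fun x => ne_top_of_le_ne_top hB (hWB x))
  have hp0 : 0 < p := by linarith
  have hpt : ∀ x, (⨆ t : {t : ℝ // δ ≤ t ∧ t ≤ m + 1}, PE d t f x) ≤ 4 * W x := by
    intro x
    refine iSup_le fun ⟨t, ht1, ht2⟩ => ?_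
    have ht0 : 0 < t := hδ0.trans_le ht1
    set n := ⌊t / δ⌋₊ with hn
    have hn1 : 1 ≤ n := by
      rw [hn, Nat.one_le_floor_iff, one_le_div hδ0]; exact ht1
    have a1 : n * δ ≤ t := by
      rw [← le_div_iff₀ hδ0]; exact Nat.floor_le (by positivity)
    have a2 : t ≤ (n + 1) * δ := by
      rw [← div_le_iff₀ hδ0]; exact (Nat.lt_floor_add_one _).le
    have a3 : n + 1 ≤ N := by
      have : (n : ℝ) ≤ ((m + 1) * (m + 1) : ℕ) := by
        rw [hδ] at a1
        rw [mul_one_div, div_le_iff₀ (by positivity)] at a1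
        push_cast
        nlinarith
      have : n ≤ (m + 1) * (m + 1) := by exact_mod_cast this
      omega
    have h1 := PE_le_avg hδ0 n hn1 a1 a2 f x
    have h2 : Ssum (PE d δ) f (n + 1) x ≤ (n + 1 : ℕ) * W x := by
      have : Ssum (PE d δ) f (n + 1) x / (n + 1 : ℕ) ≤ W x :=
        Finset.le_sup (f := fun k : ℕ => Ssum (PE d δ) f k x / k) (Finset.mem_Icc.2 ⟨by omega, a3⟩)
      rw [ENNReal.div_le_iff_le_mul (by simp) (by simp)] at this
      rwa [mul_comm]
    have h3 : (n : ℝ≥0∞) * PE d t f x ≤ n * (4 * W x) := by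
      calc _ ≤ 2 * ((n + 1 : ℕ) * W x) := h1.trans (by gcongr)
        _ ≤ 2 * ((2 * n : ℕ) * W x) := by
            gcongr
            omega
        _ = _ := by push_cast; ring
    exact (ENNReal.mul_le_mul_iff_right (by simp; omega) (ENNReal.natCast_ne_top _)).1 h3
  calc _ ≤ ∑' x, (4 * W x) ^ p := ENNReal.tsum_le_tsum fun x => ENNReal.rpow_le_rpow (hpt x) hp0.le
    _ = ENNReal.ofReal (4 ^ p) * ∑' x, W x ^ p := by
        rw [← ENNReal.tsum_mul_left]
        refine tsum_congr fun x => ?_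
        rw [ENNReal.mul_rpow_of_nonneg _ _ hp0.le, ← ENNReal.ofReal_rpow_of_nonneg (by norm_num) hp0.le]
        norm_num
    _ ≤ _ := by
        refine (mul_le_mul_right hmax _).trans ?_
        rw [← mul_assoc, ← ENNReal.ofReal_mul (by positivity), ← mul_assoc, ← Real.mul_rpow (by norm_num) (by norm_num)]
        norm_num

lemma maximal {d : ℕ} (p : ℝ) (hp : 1 < p) (f : (Fin d → ℤ) → ℝ≥0∞) (B : ℝ≥0∞) (hB : B ≠ ∞)
    (hf : ∀ x, f x ≤ B) :
    ∑' x, (⨆ t : {t : ℝ // 0 < t}, PE d t f x) ^ p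
      ≤ ENNReal.ofReal (8 ^ p * (p / (p - 1))) * ∑' x, f x ^ p := by
  have hp0 : 0 < p := by linarith
  set V : ℕ → (Fin d → ℤ) → ℝ≥0∞ := fun m x => ⨆ t : {t : ℝ // 1 / ((m : ℝ) + 1) ≤ t ∧ t ≤ m + 1}, PE d t f x with hV
  have hVmono : Monotone V := by
    intro m n hmn x
    refine iSup_le fun ⟨t, ht1, ht2⟩ => ?_
    have hmn' : (m : ℝ) ≤ n := by exact_mod_cast hmn
    exact le_iSup (fun t : {t : ℝ // 1 / ((n : ℝ) + 1) ≤ t ∧ t ≤ n + 1} => PE d t f x)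
      ⟨t, le_trans (one_div_le_one_div_of_le (by positivity) (by linarith)) ht1, by linarith⟩
  have hle : ∀ x, (⨆ t : {t : ℝ // 0 < t}, PE d t f x) ≤ ⨆ m, V m x := by
    intro x
    refine iSup_le fun ⟨t, ht⟩ => ?_
    obtain ⟨m1, hm1⟩ := exists_nat_one_div_lt ht
    obtain ⟨m2, hm2⟩ := exists_nat_ge t
    set m := max m1 m2
    have b1 : (m1 : ℝ) ≤ m := by exact_mod_cast le_max_left _ _
    have b2 : (m2 : ℝ) ≤ m := by exact_mod_cast le_max_right _ _
    refine le_trans ?_ (le_iSup (fun m => V m x) m)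
    exact le_iSup (fun t : {t : ℝ // 1 / ((m : ℝ) + 1) ≤ t ∧ t ≤ m + 1} => PE d t f x)
      ⟨t, le_trans (one_div_le_one_div_of_le (by positivity) (by linarith)) hm1.le, by linarith⟩
  rw [ENNReal.tsum_eq_iSup_sum]
  refine iSup_le fun s => ?_
  calc ∑ x ∈ s, (⨆ t : {t : ℝ // 0 < t}, PE d t f x) ^ p
      ≤ ∑ x ∈ s, ⨆ m, (V m x) ^ p := by
        refine Finset.sum_le_sum fun x _ => (ENNReal.rpow_le_rpow (hle x) hp0.le).trans ?_
        exact ((ENNReal.orderIsoRpow p hp0).map_iSup (fun m => V m x)).le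
    _ = ⨆ m, ∑ x ∈ s, (V m x) ^ p := by
        refine ENNReal.finsetSum_iSup_of_monotone fun x m n hmn => ?_
        exact ENNReal.rpow_le_rpow (hVmono hmn x) hp0.le
    _ ≤ _ := iSup_le fun m => (ENNReal.sum_le_tsum s).trans (max_fin p hp f B hB hf m)

end PS


namespace PS

lemma jensen_fin {ι : Type*} (s : Finset ι) (w f : ι → ℝ≥0∞) (hw : ∑ i ∈ s, w i ≤ 1) (r : ℝ) (hr : 1 ≤ r) :
    (∑ i ∈ s, w i * f i) ^ r ≤ ∑ i ∈ s, w i * f i ^ r := by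
  have h := ENNReal.rpow_arith_mean_le_arith_mean_rpow (Finset.insertNone s)
    (fun o => o.elim (1 - ∑ i ∈ s, w i) w) (fun o => o.elim 0 f) (by
      rw [Finset.sum_insertNone]; exact tsub_add_cancel_of_le hw) hr
  rw [Finset.sum_insertNone, Finset.sum_insertNone] at h
  simpa [ENNReal.zero_rpow_of_pos (show 0 < r by linarith)] using h

lemma jensen {ι : Type*} (w f : ι → ℝ≥0∞) (hw : ∑' i, w i ≤ 1) (r : ℝ) (hr : 1 ≤ r) :
    (∑' i, w i * f i) ^ r ≤ ∑' i, w i * f i ^ r := by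
  have hr0 : 0 < r := by linarith
  rw [← ENNReal.le_rpow_inv_iff hr0, ENNReal.tsum_eq_iSup_sum]
  refine iSup_le fun s => ?_
  rw [ENNReal.le_rpow_inv_iff hr0]
  exact (jensen_fin s w f ((ENNReal.sum_le_tsum s).trans hw) r hr).trans (ENNReal.sum_le_tsum s)

lemma PE_jensen {d : ℕ} {t : ℝ} (ht : 0 ≤ t) (f : (Fin d → ℤ) → ℝ≥0∞) (r : ℝ) (hr : 1 ≤ r) (x : Fin d → ℤ) :
    (PE d t f x) ^ r ≤ PE d t (fun y => f y ^ r) x :=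
  jensen _ _ (ker_sum_le' ht x) r hr

lemma PE_contr {d : ℕ} {t : ℝ} (ht : 0 ≤ t) (f : (Fin d → ℤ) → ℝ≥0∞) (r : ℝ) (hr : 1 ≤ r) :
    ∑' x, (PE d t f x) ^ r ≤ ∑' x, f x ^ r :=
  (ENNReal.tsum_le_tsum fun x => PE_jensen ht f r hr x).trans (PE_sum ht _)

lemma ofReal_U {d : ℕ} {t : ℝ} (ht : 0 < t) {f : (Fin d → ℤ) → ℝ} {B : ℝ}
    (hB : ∀ y, |f y| ≤ B) (hf : ∀ y, 0 ≤ f y) (x : Fin d → ℤ) :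
    ENNReal.ofReal (U d 0 f t x) = PE d t (fun y => ENNReal.ofReal (f y)) x := by
  unfold U PE
  rw [ENNReal.ofReal_tsum_of_nonneg (fun y => mul_nonneg (p_nonneg ht.le _) (hf y)) (U_summable ht 0 (by norm_num) hB x)]
  exact tsum_congr fun y => ENNReal.ofReal_mul (p_nonneg ht.le _)

lemma U1_sq {d : ℕ} {s t : ℝ} (hs : 0 < s) (ht : 0 < t) {f : (Fin d → ℤ) → ℝ} {B : ℝ}
    (hB : ∀ y, |f y| ≤ B) (x : Fin d → ℤ) :
    ENNReal.ofReal (U d 1 f (s + t) x ^ 2) ≤ PE d t (fun y => ENNReal.ofReal (U d 1 f s y ^ 2)) x := by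
  have h := U_semigroup hs ht 1 le_rfl hB x
  have e : ∀ a : ℝ, ENNReal.ofReal (a ^ 2) = ‖a‖ₑ ^ (2:ℝ) := by
    intro a
    rw [← sq_abs, ENNReal.ofReal_pow (abs_nonneg a), ← Real.norm_eq_abs, ofReal_norm]
    norm_cast
  simp only [e]
  refine le_trans (ENNReal.rpow_le_rpow ?_ (by norm_num)) (PE_jensen ht.le (fun y => ‖U d 1 f s y‖ₑ) 2 (by norm_num) x)
  rw [← h.tsum_eq]
  refine (enorm_tsum_le_tsum_enorm (f := fun y => J d 0 t (x - y) * U d 1 f s y)).trans ?_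
  unfold PE
  refine ENNReal.tsum_le_tsum fun y => ?_
  rw [enorm_mul, Real.enorm_eq_ofReal (p_nonneg ht.le _)]

lemma onepoint {a b : ℝ} (hab : a < b) {ψ ψ' ψ'' L H : ℝ → ℝ}
    (h1 : ∀ t, a ≤ t → HasDerivAt ψ (ψ' t) t) (h2 : ∀ t, a ≤ t → HasDerivAt ψ' (ψ'' t) t)
    (h3 : ∀ t, a ≤ t → H t - L t ≤ ψ'' t) (h4 : ∀ t, a ≤ t → 0 ≤ ψ t)
    (hH : ContinuousOn H (Set.Icc a b)) (hL : ContinuousOn L (Set.Icc a b)) :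
    ∫ t in a..b, (t - a) * (b - t) / (b - a) * (H t - L t) ≤ ψ a + ψ b := by
  have hba : 0 < b - a := by linarith
  have hk : ∀ t, HasDerivAt (fun t => (t - a) * (b - t) / (b - a)) ((a + b - 2 * t) / (b - a)) t := by
    intro t
    have := (((hasDerivAt_id t).sub_const a).mul ((hasDerivAt_id t).const_sub b)).div_const (b - a)
    refine this.congr_deriv ?_
    simp; ring
  have hk' : ∀ t, HasDerivAt (fun t => (a + b - 2 * t) / (b - a)) (-2 / (b - a)) t := by
    intro t
    have := (((hasDerivAt_id t).const_mul 2).const_sub (a + b)).div_const (b - a)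
    refine this.congr_deriv ?_
    simp
  have hg : ∀ t, a ≤ t → HasDerivAt (fun t => (t - a) * (b - t) / (b - a) * ψ' t - (a + b - 2 * t) / (b - a) * ψ t)
      ((t - a) * (b - t) / (b - a) * ψ'' t + 2 / (b - a) * ψ t) t := by
    intro t ht
    refine (((hk t).mul (h2 t ht)).sub ((hk' t).mul (h1 t ht))).congr_deriv ?_
    ring
  have := intervalIntegral.integral_le_sub_of_hasDeriv_right_of_le hab.le
    (fun t ht => (hg t ht.1).continuousAt.continuousWithinAt)
    (fun t ht => (hg t ht.1.le).hasDerivWithinAt)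
    (φ := fun t => (t - a) * (b - t) / (b - a) * (H t - L t))
    (ContinuousOn.integrableOn_Icc (by fun_prop))
    (fun t ht => by
      have k0 : 0 ≤ (t - a) * (b - t) / (b - a) :=
        div_nonneg (mul_nonneg (by linarith [ht.1]) (by linarith [ht.2])) hba.le
      have := mul_le_mul_of_nonneg_left (h3 t ht.1.le) k0
      have : 0 ≤ 2 / (b - a) * ψ t := mul_nonneg (by positivity) (h4 t ht.1.le)
      linarith)
  refine this.trans (le_of_eq ?_)
  field_simp
  ring

structure Bell (Q Qx Qy Qxx Qxy Qyy : ℝ → ℝ → ℝ) (h : ℝ → ℝ → ℝ → ℝ) : Prop where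
  dQ : ∀ {x y : ℝ → ℝ} {x' y' t : ℝ}, HasDerivAt x x' t → HasDerivAt y y' t → 0 < x t → 0 < y t →
    HasDerivAt (fun s => Q (x s) (y s)) (Qx (x t) (y t) * x' + Qy (x t) (y t) * y') t
  dQx : ∀ {x y : ℝ → ℝ} {x' y' t : ℝ}, HasDerivAt x x' t → HasDerivAt y y' t → 0 < x t → 0 < y t →
    HasDerivAt (fun s => Qx (x s) (y s)) (Qxx (x t) (y t) * x' + Qxy (x t) (y t) * y') t
  dQy : ∀ {x y : ℝ → ℝ} {x' y' t : ℝ}, HasDerivAt x x' t → HasDerivAt y y' t → 0 < x t → 0 < y t →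
    HasDerivAt (fun s => Qy (x s) (y s)) (Qxy (x t) (y t) * x' + Qyy (x t) (y t) * y') t
  nn : ∀ x y, 0 < x → 0 < y → 0 ≤ Q x y
  hnn : ∀ x y a, 0 < x → 0 < y → 0 ≤ h x y a
  hess : ∀ x y a b, 0 < x → 0 < y →
    h x y a ≤ Qxx x y * a ^ 2 + 2 * Qxy x y * a * b + Qyy x y * b ^ 2
  hcont : ContinuousOn (fun q : ℝ × ℝ × ℝ => h q.1 q.2.1 q.2.2) {q | 0 < q.1 ∧ 0 < q.2.1}

section bell
variable {Q Qx Qy Qxx Qxy Qyy : ℝ → ℝ → ℝ} {h : ℝ → ℝ → ℝ → ℝ}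

lemma Bell.tangent (B : Bell Q Qx Qy Qxx Qxy Qyy h) {x0 y0 x1 y1 : ℝ} (hx0 : 0 < x0) (hy0 : 0 < y0)
    (hx1 : 0 < x1) (hy1 : 0 < y1) :
    Qx x0 y0 * (x1 - x0) + Qy x0 y0 * (y1 - y0) ≤ Q x1 y1 - Q x0 y0 := by
  set X : ℝ → ℝ := fun s => x0 + s * (x1 - x0) with hX
  set Y : ℝ → ℝ := fun s => y0 + s * (y1 - y0) with hY
  have hXd : ∀ s, HasDerivAt X (x1 - x0) s := fun s => 
    (((hasDerivAt_id s).mul_const (x1 - x0)).const_add x0).congr_deriv (one_mul _)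
  have hYd : ∀ s, HasDerivAt Y (y1 - y0) s := fun s => 
    (((hasDerivAt_id s).mul_const (y1 - y0)).const_add y0).congr_deriv (one_mul _)
  have hpos : ∀ a b s : ℝ, 0 < a → 0 < b → 0 ≤ s → s ≤ 1 → 0 < a + s * (b - a) := by
    intro a b s ha hb h0 h1
    rcases le_total a b with h | h
    · nlinarith
    · nlinarith
  have hXp : ∀ s, 0 ≤ s → s ≤ 1 → 0 < X s := fun s h0 h1 => hpos _ _ _ hx0 hx1 h0 h1
  have hYp : ∀ s, 0 ≤ s → s ≤ 1 → 0 < Y s := fun s h0 h1 => hpos _ _ _ hy0 hy1 h0 h1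
  have hF : ∀ s, 0 ≤ s → s ≤ 1 → HasDerivAt (fun s => Q (X s) (Y s))
      (Qx (X s) (Y s) * (x1 - x0) + Qy (X s) (Y s) * (y1 - y0)) s := fun s h0 h1 =>
    B.dQ (hXd s) (hYd s) (hXp s h0 h1) (hYp s h0 h1)
  obtain ⟨c, hc, hc1⟩ := exists_hasDerivAt_eq_slope (fun s => Q (X s) (Y s)) _ (zero_lt_one' ℝ)
    (fun s hs => (hF s hs.1 hs.2).continuousAt.continuousWithinAt) (fun s hs => hF s hs.1.le hs.2.le)
  have hG : ∀ s, 0 ≤ s → s ≤ 1 → HasDerivAt (fun s => Qx (X s) (Y s) * (x1 - x0) + Qy (X s) (Y s) * (y1 - y0))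
      ((Qxx (X s) (Y s) * (x1 - x0) + Qxy (X s) (Y s) * (y1 - y0)) * (x1 - x0)
       + (Qxy (X s) (Y s) * (x1 - x0) + Qyy (X s) (Y s) * (y1 - y0)) * (y1 - y0)) s := fun s h0 h1 =>
    ((B.dQx (hXd s) (hYd s) (hXp s h0 h1) (hYp s h0 h1)).mul_const _).add
      ((B.dQy (hXd s) (hYd s) (hXp s h0 h1) (hYp s h0 h1)).mul_const _)
  obtain ⟨e, he, he1⟩ := exists_hasDerivAt_eq_slope _ _ hc.1
    (fun s hs => (hG s hs.1 (hs.2.trans hc.2.le)).continuousAt.continuousWithinAt)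
    (fun s hs => hG s hs.1.le (hs.2.le.trans hc.2.le))
  have hX0 : X 0 = x0 := by simp [hX]
  have hX1 : X 1 = x1 := by simp [hX]
  have hY0 : Y 0 = y0 := by simp [hY]
  have hY1 : Y 1 = y1 := by simp [hY]
  simp only [hX0, hX1, hY0, hY1, sub_zero, div_one] at hc1 he1
  have e0 := he.1.le
  have e1 := he.2.le.trans hc.2.le
  have p1 := B.hess (X e) (Y e) (x1 - x0) (y1 - y0) (hXp e e0 e1) (hYp e e0 e1)
  have p2 := B.hnn (X e) (Y e) (x1 - x0) (hXp e e0 e1) (hYp e e0 e1)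
  rw [_root_.eq_div_iff hc.1.ne'] at he1
  have p3 : 0 ≤ ((Qxx (X e) (Y e) * (x1 - x0) + Qxy (X e) (Y e) * (y1 - y0)) * (x1 - x0)
       + (Qxy (X e) (Y e) * (x1 - x0) + Qyy (X e) (Y e) * (y1 - y0)) * (y1 - y0)) * c :=
    mul_nonneg (by linarith) hc.1.le
  linarith

lemma Bell.lap_ge {d : ℕ} (B : Bell Q Qx Qy Qxx Qxy Qyy h) {u v : (Fin d → ℤ) → ℝ}
    (hu : ∀ x, 0 < u x) (hv : ∀ x, 0 < v x) (x : Fin d → ℤ) :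
    Qx (u x) (v x) * lap u x + Qy (u x) (v x) * lap v x ≤ lap (fun x => Q (u x) (v x)) x := by
  unfold lap
  rw [mul_left_comm, mul_left_comm (Qy _ _), ← mul_add, Finset.mul_sum, Finset.mul_sum, ← Finset.sum_add_distrib]
  refine mul_le_mul_of_nonneg_left (Finset.sum_le_sum fun k _ => ?_) (by norm_num)
  have h1 := B.tangent (hu x) (hv x) (hu (x + Pi.single k 1)) (hv (x + Pi.single k 1))
  have h2 := B.tangent (hu x) (hv x) (hu (x - Pi.single k 1)) (hv (x - Pi.single k 1))
  linarith

end bell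
end PS


namespace PS

noncomputable def kf (a b t : ℝ) : ℝ := (t - a) * (b - t) / (b - a)

lemma kf_nonneg {a b t : ℝ} (h1 : a ≤ t) (h2 : t ≤ b) : 0 ≤ kf a b t :=
  div_nonneg (mul_nonneg (by linarith) (by linarith)) (by linarith)

lemma kf_cont (a b : ℝ) : Continuous (kf a b) := by unfold kf; fun_prop

noncomputable def Ki (a b : ℝ) (g : ℝ → ℝ) : ℝ≥0∞ := ∫⁻ t in Set.Ioc a b, ENNReal.ofReal (kf a b t * g t)

lemma Ki_eq {a b : ℝ} (hab : a < b) {g : ℝ → ℝ} (hg : ContinuousOn g (Set.Icc a b))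
    (hg0 : ∀ t, a ≤ t → t ≤ b → 0 ≤ g t) : Ki a b g = ENNReal.ofReal (∫ t in a..b, kf a b t * g t) := by
  unfold Ki
  rw [intervalIntegral.integral_of_le hab.le, ofReal_integral_eq_lintegral_ofReal]
  · have : ContinuousOn (fun t => kf a b t * g t) (Set.Icc a b) := (kf_cont a b).continuousOn.mul hg
    exact this.integrableOn_Icc.mono_set Set.Ioc_subset_Icc_self
  · refine (ae_restrict_iff' measurableSet_Ioc).2 (Filter.Eventually.of_forall fun t ht => ?_)
    exact mul_nonneg (kf_nonneg ht.1.le ht.2) (hg0 t ht.1.le ht.2)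

lemma stepB {d : ℕ} {a b : ℝ} (hab : a < b) (ψ : ℝ → (Fin d → ℤ) → ℝ) (H : ℝ → ℝ)
    (hψc : ∀ x, ContinuousOn (fun t => ψ t x) (Set.Icc a b)) (hHc : ContinuousOn H (Set.Icc a b))
    (hψ0 : ∀ t x, a ≤ t → t ≤ b → 0 ≤ ψ t x) (hH0 : ∀ t, a ≤ t → t ≤ b → 0 ≤ H t) (x : Fin d → ℤ)
    (hA : ∫ t in a..b, kf a b t * (H t - lap (ψ t) x) ≤ ψ a x + ψ b x) :
    Ki a b H + ENNReal.ofReal (d / 2) * Ki a b (fun t => ψ t x) ≤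
      ENNReal.ofReal (ψ a x) + ENNReal.ofReal (ψ b x) +
      ∑ k : Fin d, ENNReal.ofReal (1 / 4) * (Ki a b (fun t => ψ t (x + Pi.single k 1)) + Ki a b (fun t => ψ t (x - Pi.single k 1))) := by
  have hint : ∀ g : ℝ → ℝ, ContinuousOn g (Set.Icc a b) → IntervalIntegrable (fun t => kf a b t * g t) volume a b := by
    intro g hg
    refine ContinuousOn.intervalIntegrable ?_
    rw [Set.uIcc_of_le hab.le]
    exact (kf_cont a b).continuousOn.mul hg
  have hIn : ∀ g : ℝ → ℝ, (∀ t, a ≤ t → t ≤ b → 0 ≤ g t) → 0 ≤ ∫ t in a..b, kf a b t * g t := by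
    intro g hg
    refine intervalIntegral.integral_nonneg hab.le fun t ht => mul_nonneg (kf_nonneg ht.1 ht.2) (hg t ht.1 ht.2)
  have hn : ∀ x, 0 ≤ ∫ t in a..b, kf a b t * ψ t x := fun x => hIn _ fun t h1 h2 => hψ0 t x h1 h2
  have hI := fun x => hint _ (hψc x)
  have key : ∫ t in a..b, kf a b t * (H t - lap (ψ t) x) = (∫ t in a..b, kf a b t * H t)
      - 1 / 4 * ∑ k : Fin d, ((∫ t in a..b, kf a b t * ψ t (x + Pi.single k 1)) +
        (∫ t in a..b, kf a b t * ψ t (x - Pi.single k 1)) - 2 * ∫ t in a..b, kf a b t * ψ t x) := by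
    have e : ∀ t, kf a b t * (H t - lap (ψ t) x) = kf a b t * H t - 1 / 4 * ∑ k : Fin d,
        (kf a b t * ψ t (x + Pi.single k 1) + kf a b t * ψ t (x - Pi.single k 1) - 2 * (kf a b t * ψ t x)) := by
      intro t
      unfold lap
      rw [mul_sub, mul_left_comm, Finset.mul_sum]
      congr 2
      exact Finset.sum_congr rfl fun k _ => by ring
    simp_rw [e]
    have i1 : ∀ k : Fin d, IntervalIntegrable (fun t => kf a b t * ψ t (x + Pi.single k 1) + kf a b t * ψ t (x - Pi.single k 1) - 2 * (kf a b t * ψ t x)) volume a b :=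
      fun k => ((hI _).add (hI _)).sub ((hI x).const_mul 2)
    have i2 : IntervalIntegrable (fun t => ∑ k : Fin d, (kf a b t * ψ t (x + Pi.single k 1) + kf a b t * ψ t (x - Pi.single k 1) - 2 * (kf a b t * ψ t x))) volume a b :=
      by
        have := IntervalIntegrable.sum Finset.univ (fun k _ => i1 k)
        simpa [Finset.sum_fn] using this
    rw [intervalIntegral.integral_sub (hint H hHc) (i2.const_mul _), intervalIntegral.integral_const_mul,
      intervalIntegral.integral_finsetSum fun k _ => i1 k]
    congr 2
    refine Finset.sum_congr rfl fun k _ => ?_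
    rw [intervalIntegral.integral_sub ((hI _).add (hI _)) ((hI x).const_mul 2), intervalIntegral.integral_add (hI _) (hI _),
      intervalIntegral.integral_const_mul]
  rw [key] at hA
  have hψx := hn x
  rw [Ki_eq hab hHc hH0]
  have hK : ∀ x, Ki a b (fun t => ψ t x) = ENNReal.ofReal (∫ t in a..b, kf a b t * ψ t x) :=
    fun x => Ki_eq hab (hψc x) fun t h1 h2 => hψ0 t x h1 h2
  simp only [hK]
  have e1 : ∀ k : Fin d, ENNReal.ofReal (1 / 4) * (ENNReal.ofReal (∫ t in a..b, kf a b t * ψ t (x + Pi.single k 1)) +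
      ENNReal.ofReal (∫ t in a..b, kf a b t * ψ t (x - Pi.single k 1)))
      = ENNReal.ofReal (1 / 4 * ((∫ t in a..b, kf a b t * ψ t (x + Pi.single k 1)) + ∫ t in a..b, kf a b t * ψ t (x - Pi.single k 1))) := by
    intro k
    rw [← ENNReal.ofReal_add (hn _) (hn _), ← ENNReal.ofReal_mul (by norm_num)]
  simp only [e1]
  have nn1 : ∀ k : Fin d, k ∈ Finset.univ → 0 ≤ 1 / 4 * ((∫ t in a..b, kf a b t * ψ t (x + Pi.single k 1)) + ∫ t in a..b, kf a b t * ψ t (x - Pi.single k 1)) :=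
    fun k _ => by have := hn (x + Pi.single k 1); have := hn (x - Pi.single k 1); positivity
  rw [← ENNReal.ofReal_sum_of_nonneg nn1]
  have p1 := hψ0 a x le_rfl hab.le
  have p2 := hψ0 b x hab.le le_rfl
  rw [← ENNReal.ofReal_mul (by positivity), ← ENNReal.ofReal_add (hIn H hH0) (by positivity),
    ← ENNReal.ofReal_add p1 p2, ← ENNReal.ofReal_add (by positivity) (Finset.sum_nonneg nn1)]
  apply ENNReal.ofReal_le_ofReal
  rw [← Finset.mul_sum]
  simp only [Finset.sum_sub_distrib, Finset.sum_const, Finset.card_univ, Fintype.card_fin, nsmul_eq_mul] at hA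
  linarith

lemma stepC {d : ℕ} {a b : ℝ} (A K Pa Pb : (Fin d → ℤ) → ℝ≥0∞) (hK : ∑' x, K x ≠ ∞)
    (h : ∀ x, A x + ENNReal.ofReal (d / 2) * K x ≤ Pa x + Pb x +
      ∑ k : Fin d, ENNReal.ofReal (1 / 4) * (K (x + Pi.single k 1) + K (x - Pi.single k 1))) :
    ∑' x, A x ≤ ∑' x, Pa x + ∑' x, Pb x := by
  have h1 := ENNReal.tsum_le_tsum h
  rw [ENNReal.tsum_add, ENNReal.tsum_add, ENNReal.tsum_add, ENNReal.tsum_mul_left,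
    Summable.tsum_finsetSum (fun _ _ => ENNReal.summable)] at h1
  have e : ∀ k : Fin d, ∑' x : Fin d → ℤ, ENNReal.ofReal (1 / 4) * (K (x + Pi.single k 1) + K (x - Pi.single k 1))
      = ENNReal.ofReal (1 / 2) * ∑' x, K x := by
    intro k
    have t1 := (Equiv.addRight (Pi.single k (1:ℤ) : Fin d → ℤ)).tsum_eq K
    have t2 := (Equiv.subRight (Pi.single k (1:ℤ) : Fin d → ℤ)).tsum_eq K
    simp only [Equiv.coe_addRight, Equiv.subRight_apply] at t1 t2
    rw [ENNReal.tsum_mul_left, ENNReal.tsum_add, t1, t2, ← two_mul, ← mul_assoc]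
    congr 1
    rw [show (2:ℝ≥0∞) = ENNReal.ofReal 2 by norm_num, ← ENNReal.ofReal_mul (by norm_num)]
    norm_num
  simp only [e, Finset.sum_const, Finset.card_univ, Fintype.card_fin, nsmul_eq_mul] at h1
  have e2 : (d : ℝ≥0∞) * (ENNReal.ofReal (1 / 2) * ∑' x, K x) = ENNReal.ofReal (d / 2) * ∑' x, K x := by
    rw [← mul_assoc, ← ENNReal.ofReal_natCast d, ← ENNReal.ofReal_mul (by positivity)]
    congr 2; ring
  rw [e2] at h1
  exact (ENNReal.add_le_add_iff_right (ENNReal.mul_ne_top ENNReal.ofReal_ne_top hK)).1 h1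

section bell
variable {Q Qx Qy Qxx Qxy Qyy : ℝ → ℝ → ℝ} {h : ℝ → ℝ → ℝ → ℝ}

lemma Bell.main {d : ℕ} (BQ : Bell Q Qx Qy Qxx Qxy Qyy h) {f φ : (Fin d → ℤ) → ℝ} {B : ℝ}
    (hf0 : ∀ y, 0 ≤ f y) (hφ0 : ∀ y, 0 ≤ φ y) (hfB : ∀ y, |f y| ≤ B) (hφB : ∀ y, |φ y| ≤ B)
    (y0 y1 : Fin d → ℤ) (hy0 : f y0 ≠ 0) (hy1 : φ y1 ≠ 0) (Λ : ℝ≥0∞) (hΛ : Λ ≠ ∞)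
    (hQ : ∀ t, 0 < t → ∑' x, ENNReal.ofReal (Q (U d 0 f t x) (U d 0 φ t x)) ≤ Λ) :
    ∫⁻ t in Set.Ioi (0:ℝ), ENNReal.ofReal t *
      ∑' x, ENNReal.ofReal (h (U d 0 f t x) (U d 0 φ t x) (- U d 1 f t x)) ≤ 8 * Λ := by
  set ψ : ℝ → (Fin d → ℤ) → ℝ := fun t x => Q (U d 0 f t x) (U d 0 φ t x) with hψ
  set H : ℝ → (Fin d → ℤ) → ℝ := fun t x => h (U d 0 f t x) (U d 0 φ t x) (- U d 1 f t x) with hH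
  have fp : ∀ t, 0 < t → ∀ x, 0 < U d 0 f t x := fun t ht x => U_pos ht hfB hf0 y0 hy0 x
  have φp : ∀ t, 0 < t → ∀ x, 0 < U d 0 φ t x := fun t ht x => U_pos ht hφB hφ0 y1 hy1 x
  have df : ∀ t, 0 < t → ∀ x, HasDerivAt (fun t => U d 0 f t x) (-U d 1 f t x) t :=
    fun t ht x => U_hasDerivAt ht 0 (by norm_num) hfB x
  have dφ : ∀ t, 0 < t → ∀ x, HasDerivAt (fun t => U d 0 φ t x) (-U d 1 φ t x) t :=
    fun t ht x => U_hasDerivAt ht 0 (by norm_num) hφB x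
  have d2f : ∀ t, 0 < t → ∀ x, HasDerivAt (fun t => -U d 1 f t x) (U d 2 f t x) t :=
    fun t ht x => (U_hasDerivAt ht 1 (by norm_num) hfB x).neg.congr_deriv (neg_neg _)
  have d2φ : ∀ t, 0 < t → ∀ x, HasDerivAt (fun t => -U d 1 φ t x) (U d 2 φ t x) t :=
    fun t ht x => (U_hasDerivAt ht 1 (by norm_num) hφB x).neg.congr_deriv (neg_neg _)
  have dψ : ∀ t, 0 < t → ∀ x, HasDerivAt (fun t => ψ t x) (Qx (U d 0 f t x) (U d 0 φ t x) * (-U d 1 f t x)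
      + Qy (U d 0 f t x) (U d 0 φ t x) * (-U d 1 φ t x)) t := fun t ht x =>
    BQ.dQ (df t ht x) (dφ t ht x) (fp t ht x) (φp t ht x)
  have d2ψ : ∀ t, 0 < t → ∀ x, HasDerivAt (fun t => Qx (U d 0 f t x) (U d 0 φ t x) * (-U d 1 f t x)
      + Qy (U d 0 f t x) (U d 0 φ t x) * (-U d 1 φ t x))
      ((Qxx (U d 0 f t x) (U d 0 φ t x) * (-U d 1 f t x) + Qxy (U d 0 f t x) (U d 0 φ t x) * (-U d 1 φ t x)) * (-U d 1 f t x)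
        + Qx (U d 0 f t x) (U d 0 φ t x) * U d 2 f t x
       + ((Qxy (U d 0 f t x) (U d 0 φ t x) * (-U d 1 f t x) + Qyy (U d 0 f t x) (U d 0 φ t x) * (-U d 1 φ t x)) * (-U d 1 φ t x)
        + Qy (U d 0 f t x) (U d 0 φ t x) * U d 2 φ t x)) t := fun t ht x =>
    ((BQ.dQx (df t ht x) (dφ t ht x) (fp t ht x) (φp t ht x)).mul (d2f t ht x)).add
      ((BQ.dQy (df t ht x) (dφ t ht x) (fp t ht x) (φp t ht x)).mul (d2φ t ht x))
  have ψ0 : ∀ t, 0 < t → ∀ x, 0 ≤ ψ t x := fun t ht x => BQ.nn _ _ (fp t ht x) (φp t ht x)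
  have H0 : ∀ t, 0 < t → ∀ x, 0 ≤ H t x := fun t ht x => BQ.hnn _ _ _ (fp t ht x) (φp t ht x)
  have ψc : ∀ x, ContinuousOn (fun t => ψ t x) (Set.Ioi 0) := fun x t ht =>
    (dψ t ht x).continuousAt.continuousWithinAt
  have Hc : ∀ x, ContinuousOn (fun t => H t x) (Set.Ioi 0) := by
    intro x
    have hq : ContinuousOn (fun t => (U d 0 f t x, U d 0 φ t x, -U d 1 f t x)) (Set.Ioi 0) := fun t ht =>
      ((df t ht x).continuousAt.prodMk ((dφ t ht x).continuousAt.prodMk (d2f t ht x).continuousAt)).continuousWithinAt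
    exact BQ.hcont.comp hq (fun t ht => ⟨fp t ht x, φp t ht x⟩)
  have ineq : ∀ t, 0 < t → ∀ x, H t x - lap (ψ t) x ≤ ((Qxx (U d 0 f t x) (U d 0 φ t x) * (-U d 1 f t x) + Qxy (U d 0 f t x) (U d 0 φ t x) * (-U d 1 φ t x)) * (-U d 1 f t x)
        + Qx (U d 0 f t x) (U d 0 φ t x) * U d 2 f t x
       + ((Qxy (U d 0 f t x) (U d 0 φ t x) * (-U d 1 f t x) + Qyy (U d 0 f t x) (U d 0 φ t x) * (-U d 1 φ t x)) * (-U d 1 φ t x)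
        + Qy (U d 0 f t x) (U d 0 φ t x) * U d 2 φ t x)) := by
    intro t ht x
    have h1 := BQ.lap_ge (fp t ht) (φp t ht) x
    have h2 := BQ.hess _ _ (-U d 1 f t x) (-U d 1 φ t x) (fp t ht x) (φp t ht x)
    have h3 : U d 2 f t x = - lap (U d 0 f t) x := by rw [U_lap ht hfB]; ring
    have h4 : U d 2 φ t x = - lap (U d 0 φ t) x := by rw [U_lap ht hφB]; ring
    rw [h3, h4]
    simp only [hH, hψ]
    linarith
  have hmK : ∀ x a b, 0 < a → AEMeasurable (fun t => ENNReal.ofReal (kf a b t * ψ t x)) (volume.restrict (Set.Ioc a b)) := by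
    intro x a b ha
    refine ENNReal.measurable_ofReal.comp_aemeasurable (ContinuousOn.aemeasurable ?_ measurableSet_Ioc)
    exact (kf_cont a b).continuousOn.mul ((ψc x).mono fun t ht => ha.trans ht.1)
  have main1 : ∀ a b, 0 < a → a < b → ∑' x, Ki a b (fun t => H t x) ≤ 2 * Λ := by
    intro a b ha hab
    have hsub : Set.Icc a b ⊆ Set.Ioi 0 := fun t ht => ha.trans_le ht.1
    have := stepC (a := a) (b := b) (fun x => Ki a b (fun t => H t x)) (fun x => Ki a b (fun t => ψ t x))
      (fun x => ENNReal.ofReal (ψ a x)) (fun x => ENNReal.ofReal (ψ b x)) (by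
        unfold Ki
        rw [← lintegral_tsum fun x => hmK x a b ha]
        have : ∫⁻ t in Set.Ioc a b, ∑' x, ENNReal.ofReal (kf a b t * ψ t x) ≤ ∫⁻ t in Set.Ioc a b, ENNReal.ofReal (b - a) * Λ := by
          refine setLIntegral_mono' measurableSet_Ioc fun t ht => ?_
          have hk := kf_nonneg ht.1.le ht.2
          simp_rw [ENNReal.ofReal_mul hk]
          rw [ENNReal.tsum_mul_left]
          refine mul_le_mul' (ENNReal.ofReal_le_ofReal ?_) (hQ t (ha.trans ht.1))
          unfold kf
          rw [div_le_iff₀ (by linarith)]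
          nlinarith [ht.1, ht.2]
        refine ne_top_of_le_ne_top ?_ this
        rw [setLIntegral_const]
        exact ENNReal.mul_ne_top (ENNReal.mul_ne_top ENNReal.ofReal_ne_top hΛ) (by simp)) (by
        intro x
        refine stepB hab ψ (fun t => H t x) (fun x => (ψc x).mono hsub) ((Hc x).mono hsub)
          (fun t x h1 _ => ψ0 t (ha.trans_le h1) x) (fun t h1 _ => H0 t (ha.trans_le h1) x) x ?_
        have lc : ContinuousOn (fun t => lap (ψ t) x) (Set.Icc a b) := by
          unfold lap
          refine continuousOn_const.mul (continuousOn_finsetSum _ fun k _ => ?_)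
          have c := fun x => (ψc x).mono hsub
          exact ((c _).add (c _)).sub (continuousOn_const.mul (c _))
        exact onepoint hab (fun t ht => dψ t (ha.trans_le ht) x) (fun t ht => d2ψ t (ha.trans_le ht) x)
          (fun t ht => ineq t (ha.trans_le ht) x) (fun t ht => ψ0 t (ha.trans_le ht) x) ((Hc x).mono hsub) lc)
    refine this.trans ?_
    rw [two_mul]
    exact add_le_add (hQ a ha) (hQ b (ha.trans hab))
  have hmH : ∀ x, AEMeasurable (fun t => ENNReal.ofReal (H t x)) (volume.restrict (Set.Ioi 0)) := fun x =>
    ENNReal.measurable_ofReal.comp_aemeasurable (ContinuousOn.aemeasurable (Hc x) measurableSet_Ioi)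
  have main2 : ∀ a b, 0 < a → a < b → ∫⁻ t in Set.Ioc a b, ENNReal.ofReal t * ∑' x, ENNReal.ofReal (H t x) ≤ 8 * Λ := by
    intro a b ha hab
    have h1 := main1 (a / 2) (2 * b) (by positivity) (by linarith)
    have hsub : Set.Ioc a b ⊆ Set.Ioc (a / 2) (2 * b) := Set.Ioc_subset_Ioc (by linarith) (by linarith)
    have hm2 : ∀ x, AEMeasurable (fun t => ENNReal.ofReal (kf (a/2) (2*b) t * H t x)) (volume.restrict (Set.Ioc (a/2) (2*b))) := by
      intro x
      refine ENNReal.measurable_ofReal.comp_aemeasurable (ContinuousOn.aemeasurable ?_ measurableSet_Ioc)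
      exact (kf_cont _ _).continuousOn.mul ((Hc x).mono fun t ht => (half_pos ha).trans ht.1)
    calc ∫⁻ t in Set.Ioc a b, ENNReal.ofReal t * ∑' x, ENNReal.ofReal (H t x)
        ≤ ∫⁻ t in Set.Ioc a b, 4 * ∑' x, ENNReal.ofReal (kf (a/2) (2*b) t * H t x) := by
          refine setLIntegral_mono' measurableSet_Ioc fun t ht => ?_
          have hk : t / 4 ≤ kf (a/2) (2*b) t := by
            unfold kf
            rw [le_div_iff₀ (by linarith)]
            have e1 : t / 2 ≤ t - a / 2 := by linarith [ht.1]
            have e2 : (2 * b - a / 2) / 2 ≤ 2 * b - t := by linarith [ht.2]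
            have ht0 : 0 < t := ha.trans ht.1
            calc t / 4 * (2 * b - a / 2) = t / 2 * ((2 * b - a / 2) / 2) := by ring
              _ ≤ _ := mul_le_mul e1 e2 (by linarith) (by linarith)
          have ht0 : 0 < t := ha.trans ht.1
          have hk0 : 0 ≤ kf (a/2) (2*b) t := le_trans (by positivity) hk
          simp_rw [ENNReal.ofReal_mul hk0]
          rw [ENNReal.tsum_mul_left, ← mul_assoc]
          refine mul_le_mul_left ?_ _
          rw [show (4:ℝ≥0∞) = ENNReal.ofReal 4 by norm_num, ← ENNReal.ofReal_mul (by norm_num)]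
          exact ENNReal.ofReal_le_ofReal (by linarith)
      _ ≤ ∫⁻ t in Set.Ioc (a/2) (2*b), 4 * ∑' x, ENNReal.ofReal (kf (a/2) (2*b) t * H t x) :=
          lintegral_mono_set hsub
      _ = 4 * ∑' x, Ki (a/2) (2*b) (fun t => H t x) := by
          rw [lintegral_const_mul' _ _ (by norm_num), lintegral_tsum hm2]
          rfl
      _ ≤ 4 * (2 * Λ) := by gcongr
      _ = 8 * Λ := by rw [← mul_assoc]; norm_num
  have hU : Set.Ioi (0:ℝ) = ⋃ m : ℕ, Set.Ioc (1 / ((m:ℝ) + 2)) (m + 1) := by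
    ext t
    simp only [Set.mem_Ioi, Set.mem_iUnion, Set.mem_Ioc]
    constructor
    · intro ht
      obtain ⟨m1, hm1⟩ := exists_nat_one_div_lt ht
      obtain ⟨m2, hm2⟩ := exists_nat_ge t
      have b1 : (m1 : ℝ) ≤ (max m1 m2 : ℕ) := by exact_mod_cast le_max_left _ _
      have b2 : (m2 : ℝ) ≤ (max m1 m2 : ℕ) := by exact_mod_cast le_max_right _ _
      exact ⟨max m1 m2, lt_of_le_of_lt (one_div_le_one_div_of_le (by positivity) (by linarith)) hm1, by linarith⟩
    · rintro ⟨m, h1, _⟩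
      exact lt_trans (by positivity) h1
  rw [hU, setLIntegral_iUnion_of_directed]
  · refine iSup_le fun m => main2 _ _ (by positivity) ?_
    rw [div_lt_iff₀ (by positivity)]
    have : (0:ℝ) ≤ m := by positivity
    nlinarith
  · apply Monotone.directed_le
    intro m n hmn
    have : (m : ℝ) ≤ n := by exact_mod_cast hmn
    exact Set.Ioc_subset_Ioc (one_div_le_one_div_of_le (by positivity) (by linarith)) (by linarith)

end bell
end PS


namespace PS

lemma bellA (p : ℝ) (hp : 1 < p) : Bell (fun x _ => x ^ p) (fun x _ => p * x ^ (p - 1)) (fun _ _ => 0)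
    (fun x _ => p * (p - 1) * x ^ (p - 2)) (fun _ _ => 0) (fun _ _ => 0)
    (fun x _ a => p * (p - 1) * x ^ (p - 2) * a ^ 2) where
  dQ := by
    intro x y x' y' t hx hy px py
    refine (hx.rpow_const (Or.inl px.ne')).congr_deriv ?_
    ring
  dQx := by
    intro x y x' y' t hx hy px py
    refine ((hx.rpow_const (Or.inl px.ne')).const_mul p).congr_deriv ?_
    rw [show p - 1 - 1 = p - 2 by ring]
    ring
  dQy := by
    intro x y x' y' t hx hy px py
    refine (hasDerivAt_const t (0:ℝ)).congr_deriv ?_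
    ring
  nn := by intro x y hx hy; positivity
  hnn := by
    intro x y a hx hy
    have : 0 < p - 1 := by linarith
    positivity
  hess := by
    intro x y a b hx hy
    simp
  hcont := by
    refine ContinuousOn.mul (ContinuousOn.mul continuousOn_const ?_) (by fun_prop)
    exact ContinuousOn.rpow_const (by fun_prop) fun q hq => Or.inl (ne_of_gt hq.1)

lemma bellB (p : ℝ) (hp : 2 < p) (hp4 : p ≤ 4) : ∃ (Q Qx Qy Qxx Qxy Qyy : ℝ → ℝ → ℝ) (C : ℝ), 0 < C ∧
    Bell Q Qx Qy Qxx Qxy Qyy (fun _ y a => y * a ^ 2) ∧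
    ∀ x y, 0 < x → 0 < y → Q x y ≤ C * (x ^ p + y ^ (p / (p - 2))) := by
  set q := p / 2 with hq
  set β := 2 / (p - 2) with hβ
  have hp2 : 0 < p - 2 := by linarith
  have hβ1 : 1 ≤ β := by rw [hβ, one_le_div hp2]; linarith
  have hq1 : 1 < q := by rw [hq]; linarith
  have hR : ∀ x y : ℝ, 0 < x → 0 < y → 0 < x ^ 2 + y ^ β := fun x y hx hy => by positivity
  have dR : ∀ {x y : ℝ → ℝ} {x' y' t : ℝ}, HasDerivAt x x' t → HasDerivAt y y' t → 0 < x t → 0 < y t → ∀ e : ℝ,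
    HasDerivAt (fun s => (x s ^ 2 + y s ^ β) ^ e)
      ((2 * x t * x' + β * y t ^ (β - 1) * y') * e * (x t ^ 2 + y t ^ β) ^ (e - 1)) t := by
    intro x y x' y' t hx hy px py e
    refine (((hx.pow 2).add (hy.rpow_const (Or.inl py.ne'))).rpow_const (Or.inl (hR _ _ px py).ne')).congr_deriv ?_
    change (((2:ℕ):ℝ) * x t ^ (2-1) * x' + y' * β * y t ^ (β-1)) * e * (x t ^ 2 + y t ^ β)^(e-1) = _
    push_cast; ring
  refine ⟨fun x y => (x ^ 2 + y ^ β) ^ q, fun x y => q * (x ^ 2 + y ^ β) ^ (q - 1) * (2 * x),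
    fun x y => q * (x ^ 2 + y ^ β) ^ (q - 1) * (β * y ^ (β - 1)),
    fun x y => q * (q - 1) * (x ^ 2 + y ^ β) ^ (q - 1 - 1) * (4 * x ^ 2) + 2 * q * (x ^ 2 + y ^ β) ^ (q - 1),
    fun x y => q * (q - 1) * (x ^ 2 + y ^ β) ^ (q - 1 - 1) * (2 * x) * (β * y ^ (β - 1)),
    fun x y => q * (q - 1) * (x ^ 2 + y ^ β) ^ (q - 1 - 1) * (β * y ^ (β - 1)) ^ 2
      + q * (x ^ 2 + y ^ β) ^ (q - 1) * (β * (β - 1) * y ^ (β - 1 - 1)), 2 ^ q, by positivity, ?_, ?_⟩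
  · constructor
    · intro x y x' y' t hx hy px py
      refine (dR hx hy px py q).congr_deriv ?_
      ring
    · intro x y x' y' t hx hy px py
      refine (((dR hx hy px py (q - 1)).const_mul q).mul (hx.const_mul 2)).congr_deriv ?_
      ring
    · intro x y x' y' t hx hy px py
      refine (((dR hx hy px py (q - 1)).const_mul q).mul
        ((hy.rpow_const (p := β - 1) (Or.inl py.ne')).const_mul β)).congr_deriv ?_
      ring
    · intro x y hx hy; positivity
    · intro x y a hx hy; positivity
    · intro x y a b hx hy
      have hR0 := hR x y hx hy
      have e1 : y ≤ (x ^ 2 + y ^ β) ^ (q - 1) := by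
        calc y = (y ^ β) ^ (q - 1) := by
              rw [← Real.rpow_mul hy.le]
              have : β * (q - 1) = 1 := by rw [hβ, hq]; field_simp
              rw [this, Real.rpow_one]
          _ ≤ _ := Real.rpow_le_rpow (by positivity) (by nlinarith) (by linarith)
      have e2 : 0 ≤ q * (q - 1) * (x ^ 2 + y ^ β) ^ (q - 1 - 1) * (2 * x * a + β * y ^ (β - 1) * b) ^ 2 := by
        have : 0 < q - 1 := by linarith
        positivity
      have e3 : 0 ≤ q * (x ^ 2 + y ^ β) ^ (q - 1) * (β * (β - 1) * y ^ (β - 1 - 1)) * b ^ 2 := by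
        have : 0 ≤ β - 1 := by linarith
        positivity
      have e4 : y * a ^ 2 ≤ 2 * q * (x ^ 2 + y ^ β) ^ (q - 1) * a ^ 2 := by
        refine mul_le_mul_of_nonneg_right ?_ (sq_nonneg a)
        nlinarith
      linarith
    · fun_prop
  · intro x y hx hy
    have k : ∀ M : ℝ, 0 < M → x ^ 2 ≤ M → y ^ β ≤ M → (x ^ 2 + y ^ β) ^ q ≤ 2 ^ q * M ^ q := by
      intro M hM h1 h2
      rw [← Real.mul_rpow (by norm_num) hM.le]
      exact Real.rpow_le_rpow (by positivity) (by linarith) (by linarith)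
    have x1 : (x ^ 2) ^ q = x ^ p := by
      rw [← Real.rpow_natCast, ← Real.rpow_mul hx.le]; congr 1; rw [hq]; push_cast; ring
    have y1 : (y ^ β) ^ q = y ^ (p / (p - 2)) := by
      rw [← Real.rpow_mul hy.le]; congr 1; rw [hβ, hq]; field_simp
    have a1 : 0 < x ^ p := by positivity
    have a2 : 0 < y ^ (p / (p - 2)) := by positivity
    have a3 : (0:ℝ) < 2 ^ q := by positivity
    rcases le_total (x ^ 2) (y ^ β) with h | h
    · have := k _ (by positivity) h le_rfl
      rw [y1] at this
      nlinarith
    · have := k _ (by positivity) le_rfl h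
      rw [x1] at this
      nlinarith

lemma young_sm (p : ℝ) (hp : 2 < p) (x y : ℝ) (hx : 0 < x) (hy : 0 < y) :
    x ^ 2 * y ≤ x ^ p + y ^ (p / (p - 2)) := by
  have hp2 : 0 < p - 2 := by linarith
  have a1 : 0 < x ^ p := by positivity
  have a2 : 0 < y ^ (p / (p - 2)) := by positivity
  rcases le_total y (x ^ (p - 2)) with h | h
  · have : x ^ 2 * x ^ (p - 2) = x ^ p := by
      rw [← Real.rpow_natCast, ← Real.rpow_add hx]; congr 1; push_cast; ring
    nlinarith [sq_nonneg x]
  · have h1 : x ≤ y ^ (p - 2)⁻¹ := by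
      rw [Real.le_rpow_inv_iff_of_pos hx.le hy.le hp2]; exact h
    have h2 : x ^ 2 ≤ y ^ (2 / (p - 2)) := by
      calc x ^ 2 ≤ (y ^ (p - 2)⁻¹) ^ 2 := by gcongr
        _ = _ := by rw [← Real.rpow_natCast, ← Real.rpow_mul hy.le]; congr 1; push_cast; field_simp
    have h3 : y ^ (2 / (p - 2)) * y = y ^ (p / (p - 2)) := by
      nth_rewrite 2 [← Real.rpow_one y]
      rw [← Real.rpow_add hy]; congr 1; field_simp; ring
    nlinarith

lemma bellC (p : ℝ) (hp4 : 4 ≤ p) : ∃ (Q Qx Qy Qxx Qxy Qyy : ℝ → ℝ → ℝ) (C : ℝ), 0 < C ∧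
    Bell Q Qx Qy Qxx Qxy Qyy (fun _ y a => y * a ^ 2) ∧
    ∀ x y, 0 < x → 0 < y → Q x y ≤ C * (x ^ p + y ^ (p / (p - 2))) := by
  set s := p / (p - 2) with hs
  have hp2 : 0 < p - 2 := by linarith
  have hs1 : s - 1 = 2 / (p - 2) := by rw [hs]; field_simp; ring
  have hs1' : 0 < s - 1 := by rw [hs1]; positivity
  have hs2 : s - 2 ≤ 0 := by
    have : s ≤ 2 := by rw [hs, div_le_iff₀ hp2]; linarith
    linarith
  have hs0 : 0 < s := by linarith
  set c := 4 / (s * (s - 1)) with hc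
  have hc0 : 0 < c := by positivity
  have hcs : c * s * (s - 1) = 4 := by rw [hc]; field_simp
  refine ⟨fun x y => x ^ 2 * y + x ^ p + c * y ^ s, fun x y => 2 * x * y + p * x ^ (p - 1),
    fun x y => x ^ 2 + c * s * y ^ (s - 1), fun x y => 2 * y + p * (p - 1) * x ^ (p - 2),
    fun x y => 2 * x, fun x y => 4 * y ^ (s - 2), 2 + c, by positivity, ?_, ?_⟩
  · constructor
    · intro x y x' y' t hx hy px py
      refine ((((hx.pow 2).mul hy).add (hx.rpow_const (Or.inl px.ne'))).add
        ((hy.rpow_const (Or.inl py.ne')).const_mul c)).congr_deriv ?_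
      simp; ring
    · intro x y x' y' t hx hy px py
      refine (((hx.const_mul 2).mul hy).add ((hx.rpow_const (p := p - 1) (Or.inl px.ne')).const_mul p)).congr_deriv ?_
      rw [show p - 1 - 1 = p - 2 by ring]
      ring
    · intro x y x' y' t hx hy px py
      refine ((hx.pow 2).add ((hy.rpow_const (p := s - 1) (Or.inl py.ne')).const_mul (c * s))).congr_deriv ?_
      rw [show s - 1 - 1 = s - 2 by ring, ← hcs]
      simp; ring
    · intro x y hx hy; positivity
    · intro x y a hx hy; positivity
    · intro x y a b hx hy
      have X : 0 < x ^ (p - 2) := by positivity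
      have Y : 0 < y ^ (s - 2) := by positivity
      have key : x ^ 2 ≤ (y + x ^ (p - 2)) * y ^ (s - 2) := by
        rcases le_total y (x ^ (p - 2)) with h | h
        · have h1 : (x ^ (p - 2)) ^ (s - 2) ≤ y ^ (s - 2) := Real.rpow_le_rpow_of_nonpos hy h hs2
          have h2 : x ^ (p - 2) * (x ^ (p - 2)) ^ (s - 2) = x ^ 2 := by
            rw [← Real.rpow_mul hx.le, ← Real.rpow_add hx, ← Real.rpow_natCast]
            congr 1
            rw [show s - 2 = (s - 1) - 1 by ring, hs1]; push_cast; field_simp; ring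
          nlinarith
        · have h1 : x ≤ y ^ (p - 2)⁻¹ := by
            rw [Real.le_rpow_inv_iff_of_pos hx.le hy.le hp2]; exact h
          have h2 : x ^ 2 ≤ y ^ (2 / (p - 2)) := by
            calc x ^ 2 ≤ (y ^ (p - 2)⁻¹) ^ 2 := by gcongr
              _ = _ := by rw [← Real.rpow_natCast, ← Real.rpow_mul hy.le]; congr 1; push_cast; field_simp
          have h3 : y * y ^ (s - 2) = y ^ (2 / (p - 2)) := by
            nth_rewrite 1 [← Real.rpow_one y]
            rw [← Real.rpow_add hy, ← hs1]; congr 1; ring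
          nlinarith
      have hpp : 1 ≤ p * (p - 1) := by nlinarith
      have k1 : 0 ≤ (y + x ^ (p - 2)) * a ^ 2 + 4 * x * a * b + 4 * y ^ (s - 2) * b ^ 2 := by
        have h5 : 0 ≤ y ^ (s - 2) * ((y + x ^ (p - 2)) * a ^ 2 + 4 * x * a * b + 4 * y ^ (s - 2) * b ^ 2) := by
          nlinarith [sq_nonneg (x * a + 2 * y ^ (s - 2) * b), mul_le_mul_of_nonneg_right key (sq_nonneg a)]
        exact nonneg_of_mul_nonneg_right h5 Y
      have k2 : x ^ (p - 2) * a ^ 2 ≤ p * (p - 1) * x ^ (p - 2) * a ^ 2 := by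
        refine mul_le_mul_of_nonneg_right ?_ (sq_nonneg a)
        nlinarith
      linarith
    · fun_prop
  · intro x y hx hy
    have := young_sm p (by linarith) x y hx hy
    have a1 : 0 < x ^ p := by positivity
    have a2 : 0 < y ^ s := by positivity
    rw [← hs] at this
    nlinarith

lemma bellBC (p : ℝ) (hp : 2 < p) : ∃ (Q Qx Qy Qxx Qxy Qyy : ℝ → ℝ → ℝ) (C : ℝ), 0 < C ∧
    Bell Q Qx Qy Qxx Qxy Qyy (fun _ y a => y * a ^ 2) ∧
    ∀ x y, 0 < x → 0 < y → Q x y ≤ C * (x ^ p + y ^ (p / (p - 2))) := by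
  rcases le_total p 4 with h | h
  · exact bellB p hp h
  · exact bellC p h

end PS


namespace PS

noncomputable def G (d : ℕ) (f : (Fin d → ℤ) → ℝ) (x : Fin d → ℤ) : ℝ≥0∞ :=
  ∫⁻ t in Set.Ioi (0:ℝ), ENNReal.ofReal t * ENNReal.ofReal (U d 1 f t x ^ 2)

lemma U_cont {d : ℕ} (n : ℕ) (hn : n ≤ 1) {f : (Fin d → ℤ) → ℝ} {B : ℝ}
    (hB : ∀ y, |f y| ≤ B) (x : Fin d → ℤ) : ContinuousOn (fun t => U d n f t x) (Set.Ioi 0) :=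
  fun _ ht => (U_hasDerivAt ht n hn hB x).continuousAt.continuousWithinAt

lemma Λ_le {d : ℕ} {f : (Fin d → ℤ) → ℝ} {B : ℝ} (hf0 : ∀ y, 0 ≤ f y) (hB : ∀ y, |f y| ≤ B)
    (r : ℝ) (hr : 1 ≤ r) {t : ℝ} (ht : 0 < t) :
    ∑' x, ENNReal.ofReal (U d 0 f t x ^ r) ≤ ∑' x, ENNReal.ofReal (f x) ^ r := by
  refine le_trans (le_of_eq (tsum_congr fun x => ?_)) (PE_contr ht.le (fun y => ENNReal.ofReal (f y)) r hr)
  rw [← ofReal_U ht hB hf0 x, ENNReal.ofReal_rpow_of_nonneg (U_nonneg ht.le hf0 x) (by linarith)]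

lemma G_zero {d : ℕ} {f : (Fin d → ℤ) → ℝ} (h : ∀ y, f y = 0) (x : Fin d → ℤ) : G d f x = 0 := by
  simp [G, U, h]

lemma sqA (p : ℝ) (hp : 1 < p) (hp2 : p ≤ 2) {d : ℕ} {f : (Fin d → ℤ) → ℝ} {B : ℝ}
    (hf0 : ∀ y, 0 ≤ f y) (hB : ∀ y, |f y| ≤ B) (hΛ : ∑' x, ENNReal.ofReal (f x) ^ p ≠ ∞) :
    ∑' x, G d f x ^ (p / 2) ≤ ENNReal.ofReal ((1 / (p * (p - 1))) ^ (p / 2) * (8 ^ p * (p / (p - 1)) + 8))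
      * ∑' x, ENNReal.ofReal (f x) ^ p := by
  by_cases hz : ∀ y, f y = 0
  · simp only [G_zero hz]
    rw [ENNReal.zero_rpow_of_pos (by linarith)]
    simp
  push Not at hz
  obtain ⟨y0, hy0⟩ := hz
  have hp0 : 0 < p := by linarith
  have hp1 : 0 < p - 1 := by linarith
  have hup : ∀ t, 0 < t → ∀ x, 0 < U d 0 f t x := fun t ht x => U_pos ht hB hf0 y0 hy0 x
  have hM := (bellA p hp).main hf0 hf0 hB hB y0 y0 hy0 hy0 _ hΛ (fun t ht => Λ_le hf0 hB p hp.le ht)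
  set v : (Fin d → ℤ) → ℝ≥0∞ := fun x => ⨆ t : {t : ℝ // 0 < t}, PE d t (fun y => ENNReal.ofReal (f y)) x with hv
  set R : (Fin d → ℤ) → ℝ≥0∞ := fun x => ∫⁻ t in Set.Ioi (0:ℝ), ENNReal.ofReal t *
    ENNReal.ofReal (p * (p - 1) * U d 0 f t x ^ (p - 2) * (-U d 1 f t x) ^ 2) with hR
  have hfB : ∀ x, ENNReal.ofReal (f x) ≤ ENNReal.ofReal B := fun x =>
    ENNReal.ofReal_le_ofReal ((le_abs_self _).trans (hB x))
  have hmax := maximal p hp (fun y => ENNReal.ofReal (f y)) (ENNReal.ofReal B) ENNReal.ofReal_ne_top hfB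
  have hvB : ∀ x, v x ≤ ENNReal.ofReal B := fun x => iSup_le fun t =>
    (PE_mono t.1 (fun y => hfB y) x).trans (PE_const t.2.le _ x)
  have hvt : ∀ x, v x ≠ ∞ := fun x => ((hvB x).trans_lt ENNReal.ofReal_lt_top).ne
  have hRs : ∑' x, R x ≤ 8 * ∑' x, ENNReal.ofReal (f x) ^ p := by
    refine le_trans (le_of_eq ?_) hM
    simp only [← ENNReal.tsum_mul_left]
    rw [lintegral_tsum]
    intro x
    have c0 := U_cont 0 (by norm_num) hB x
    have c1 := U_cont 1 (by norm_num) hB x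
    refine AEMeasurable.mul (by fun_prop) (AEMeasurable.ennreal_ofReal (ContinuousOn.aemeasurable ?_ measurableSet_Ioi))
    refine (continuousOn_const.mul (c0.rpow_const fun t ht => Or.inl (hup t ht x).ne')).mul (c1.neg.pow 2)
  have hpt : ∀ x, G d f x ^ (p / 2) ≤ ENNReal.ofReal ((1 / (p * (p - 1))) ^ (p / 2)) * (v x ^ p + R x) := by
    intro x
    have h1 : G d f x ≤ (ENNReal.ofReal (1 / (p * (p - 1))) * v x ^ (2 - p)) * R x := by
      rw [hR]
      simp only
      rw [← lintegral_const_mul' _ _ (ENNReal.mul_ne_top ENNReal.ofReal_ne_top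
        (ENNReal.rpow_ne_top_of_nonneg (by linarith) (hvt x)))]
      refine setLIntegral_mono' measurableSet_Ioi fun t ht => ?_
      have hu := hup t ht x
      have e : U d 1 f t x ^ 2 = 1 / (p * (p - 1)) * U d 0 f t x ^ (2 - p) * (p * (p - 1) * U d 0 f t x ^ (p - 2) * (-U d 1 f t x) ^ 2) := by
        have : U d 0 f t x ^ (2 - p) * U d 0 f t x ^ (p - 2) = 1 := by
          rw [← Real.rpow_add hu]; simp
        calc U d 1 f t x ^ 2 = 1 / (p * (p - 1)) * (p * (p - 1)) * (U d 0 f t x ^ (2 - p) * U d 0 f t x ^ (p - 2)) * U d 1 f t x ^ 2 := by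
              rw [this]; field_simp
          _ = _ := by ring
      rw [e, ENNReal.ofReal_mul (by positivity), ENNReal.ofReal_mul (by positivity), mul_left_comm]
      refine mul_le_mul_left (mul_le_mul_right ?_ _) _
      rw [← ENNReal.ofReal_rpow_of_pos hu]
      refine ENNReal.rpow_le_rpow ?_ (by linarith)
      rw [ofReal_U ht hB hf0 x]
      exact le_iSup (fun t : {t : ℝ // 0 < t} => PE d t (fun y => ENNReal.ofReal (f y)) x) ⟨t, ht⟩
    have h2 : v x ≤ (v x ^ p + R x) ^ (1 / p) := by
      calc v x = (v x ^ p) ^ (1 / p) := by rw [← ENNReal.rpow_mul, mul_one_div_cancel hp0.ne', ENNReal.rpow_one]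
        _ ≤ _ := ENNReal.rpow_le_rpow le_self_add (by positivity)
    have h3 : R x ≤ v x ^ p + R x := le_add_self
    set M := v x ^ p + R x with hMdef
    calc G d f x ^ (p / 2) ≤ ((ENNReal.ofReal (1 / (p * (p - 1))) * (M ^ (1 / p)) ^ (2 - p)) * M) ^ (p / 2) := by
          refine ENNReal.rpow_le_rpow (h1.trans ?_) (by positivity)
          refine mul_le_mul' (mul_le_mul_right (ENNReal.rpow_le_rpow h2 (by linarith)) _) h3
      _ = ENNReal.ofReal ((1 / (p * (p - 1))) ^ (p / 2)) * M := by
          rw [ENNReal.mul_rpow_of_nonneg _ _ (by positivity), ENNReal.mul_rpow_of_nonneg _ _ (by positivity),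
            ENNReal.ofReal_rpow_of_nonneg (by positivity) (by positivity), mul_assoc, ← ENNReal.rpow_mul, ← ENNReal.rpow_mul,
            ← ENNReal.rpow_add_of_nonneg _ _ _ (by positivity)]
          · congr 1
            rw [show 1 / p * ((2 - p) * (p / 2)) + p / 2 = 1 by field_simp; ring, ENNReal.rpow_one]
          · have : 0 ≤ 2 - p := by linarith
            positivity
  calc ∑' x, G d f x ^ (p / 2) ≤ ∑' x, ENNReal.ofReal ((1 / (p * (p - 1))) ^ (p / 2)) * (v x ^ p + R x) :=
        ENNReal.tsum_le_tsum hpt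
    _ = ENNReal.ofReal ((1 / (p * (p - 1))) ^ (p / 2)) * (∑' x, v x ^ p + ∑' x, R x) := by
        rw [ENNReal.tsum_mul_left, ENNReal.tsum_add]
    _ ≤ ENNReal.ofReal ((1 / (p * (p - 1))) ^ (p / 2)) * (ENNReal.ofReal (8 ^ p * (p / (p - 1))) * ∑' x, ENNReal.ofReal (f x) ^ p
          + 8 * ∑' x, ENNReal.ofReal (f x) ^ p) := mul_le_mul_right (add_le_add hmax hRs) _
    _ = _ := by
        rw [ENNReal.ofReal_mul (q := 8 ^ p * (p / (p - 1)) + 8) (by positivity), ENNReal.ofReal_add (by positivity) (by positivity)]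
        rw [show ENNReal.ofReal 8 = 8 by simp]
        ring

lemma G_half {d : ℕ} (f : (Fin d → ℤ) → ℝ) (x : Fin d → ℤ) :
    G d f x = 4 * ∫⁻ t in Set.Ioi (0:ℝ), ENNReal.ofReal t * ENNReal.ofReal (U d 1 f (t + t) x ^ 2) := by
  have him : (fun t : ℝ => 2 * t) '' Set.Ioi 0 = Set.Ioi 0 := by
    ext t
    simp only [Set.mem_image, Set.mem_Ioi]
    constructor
    · rintro ⟨s, hs, rfl⟩; positivity
    · intro ht; exact ⟨t / 2, by positivity, by ring⟩
  unfold G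
  conv_lhs => rw [← him]
  rw [lintegral_image_eq_lintegral_abs_deriv_mul measurableSet_Ioi (f := fun t : ℝ => 2 * t) (f' := fun _ => 2)
    (fun t _ => ((hasDerivAt_id t).const_mul 2).hasDerivWithinAt.congr_deriv (by simp))
    (fun a _ b _ h => by simpa using h)]
  rw [← lintegral_const_mul' _ _ (by norm_num)]
  refine setLIntegral_congr_fun measurableSet_Ioi fun t ht => ?_
  simp only [two_mul t]
  rw [← two_mul t, ENNReal.ofReal_mul (by norm_num), show |(2:ℝ)| = 2 by norm_num, ← mul_assoc, ← mul_assoc, ← mul_assoc]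
  rw [show ENNReal.ofReal 2 = 2 by simp, show (2:ℝ≥0∞) * 2 = 4 by norm_num]

lemma sqB1 (p : ℝ) (hp : 2 < p) : ∃ K : ℝ, 0 < K ∧ ∀ (d : ℕ) (f φ : (Fin d → ℤ) → ℝ) (B : ℝ)
    (_ : ∀ y, 0 ≤ f y) (_ : ∀ y, |f y| ≤ B) (_ : ∑' x, ENNReal.ofReal (f x) ^ p ≠ ∞) (y0 : Fin d → ℤ) (_ : f y0 ≠ 0)
    (_ : ∀ y, 0 ≤ φ y) (_ : ∀ y, |φ y| ≤ B) (_ : ∑' x, ENNReal.ofReal (φ x) ^ (p / (p - 2)) ≠ ∞) (y1 : Fin d → ℤ) (_ : φ y1 ≠ 0),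
    ∑' x, ENNReal.ofReal (φ x) * G d f x ≤ ENNReal.ofReal K *
      (∑' x, ENNReal.ofReal (f x) ^ p + ∑' x, ENNReal.ofReal (φ x) ^ (p / (p - 2))) := by
  obtain ⟨Q, Qx, Qy, Qxx, Qxy, Qyy, C, hC, hBell, hQ⟩ := bellBC p hp
  refine ⟨32 * C, by positivity, ?_⟩
  intro d f φ B hf0 hfB hf y0 hy0 hφ0 hφB hφ y1 hy1
  have hp2 : 0 < p - 2 := by linarith
  have hs : 1 ≤ p / (p - 2) := by rw [le_div_iff₀ hp2]; linarith
  have hM := hBell.main hf0 hφ0 hfB hφB y0 y1 hy0 hy1 (ENNReal.ofReal C *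
      (∑' x, ENNReal.ofReal (f x) ^ p + ∑' x, ENNReal.ofReal (φ x) ^ (p / (p - 2))))
      (ENNReal.mul_ne_top ENNReal.ofReal_ne_top (ENNReal.add_ne_top.2 ⟨hf, hφ⟩)) ?_
  · have key : ∑' x, ENNReal.ofReal (φ x) * G d f x = 4 * ∫⁻ t in Set.Ioi (0:ℝ), ENNReal.ofReal t *
        ∑' x, ENNReal.ofReal (φ x) * ENNReal.ofReal (U d 1 f (t + t) x ^ 2) := by
      simp only [← ENNReal.tsum_mul_left]
      rw [lintegral_tsum, ← ENNReal.tsum_mul_left]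
      · refine tsum_congr fun x => ?_
        rw [G_half, mul_left_comm, ← lintegral_const_mul' _ _ ENNReal.ofReal_ne_top]
        congr 1
        refine lintegral_congr fun t => ?_
        ring
      · intro x
        refine AEMeasurable.mul (by fun_prop) (AEMeasurable.mul (by fun_prop) (AEMeasurable.ennreal_ofReal (ContinuousOn.aemeasurable ?_ measurableSet_Ioi)))
        refine ContinuousOn.pow ((U_cont 1 le_rfl hfB x).comp (by fun_prop) fun t ht => ?_) 2
        simp only [Set.mem_Ioi] at ht ⊢
        linarith
    rw [key]
    have : ∫⁻ t in Set.Ioi (0:ℝ), ENNReal.ofReal t *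
        ∑' x, ENNReal.ofReal (φ x) * ENNReal.ofReal (U d 1 f (t + t) x ^ 2) ≤ _ := le_trans ?_ hM
    · refine (mul_le_mul_right this 4).trans (le_of_eq ?_)
      rw [ENNReal.ofReal_mul (by norm_num), show ENNReal.ofReal 32 = 32 by simp]
      rw [← mul_assoc, ← mul_assoc, show (4:ℝ≥0∞) * 8 = 32 by norm_num]
    · refine setLIntegral_mono' measurableSet_Ioi fun t ht => ?_
      refine mul_le_mul_right ?_ _
      calc ∑' x, ENNReal.ofReal (φ x) * ENNReal.ofReal (U d 1 f (t + t) x ^ 2)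
          ≤ ∑' x, ENNReal.ofReal (φ x) * PE d t (fun y => ENNReal.ofReal (U d 1 f t y ^ 2)) x :=
            ENNReal.tsum_le_tsum fun x => mul_le_mul_right (U1_sq ht ht hfB x) _
        _ = _ := PE_symm t (fun y => ENNReal.ofReal (U d 1 f t y ^ 2)) (fun y => ENNReal.ofReal (φ y))
        _ = _ := by
            refine tsum_congr fun x => ?_
            rw [← ofReal_U ht hφB hφ0 x, ← ENNReal.ofReal_mul (U_nonneg (le_of_lt ht) hφ0 x), neg_sq]
  · intro t ht
    calc _ ≤ ∑' x, ENNReal.ofReal C * (ENNReal.ofReal (U d 0 f t x ^ p) + ENNReal.ofReal (U d 0 φ t x ^ (p / (p - 2)))) := by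
          refine ENNReal.tsum_le_tsum fun x => ?_
          have h1 := U_pos ht hfB hf0 y0 hy0 x
          have h2 := U_pos ht hφB hφ0 y1 hy1 x
          rw [← ENNReal.ofReal_add (by positivity) (by positivity), ← ENNReal.ofReal_mul hC.le]
          exact ENNReal.ofReal_le_ofReal (hQ _ _ h1 h2)
      _ ≤ _ := by
          rw [ENNReal.tsum_mul_left, ENNReal.tsum_add]
          exact mul_le_mul_right (add_le_add (Λ_le hf0 hfB p (by linarith) ht) (Λ_le hφ0 hφB _ hs ht)) _

set_option maxHeartbeats 1000000 in
lemma sqB (p : ℝ) (hp : 2 < p) : ∃ K : ℝ, 0 < K ∧ ∀ (d : ℕ) (f : (Fin d → ℤ) → ℝ) (B : ℝ)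
    (_ : ∀ y, 0 ≤ f y) (_ : ∀ y, |f y| ≤ B) (_ : ∑' x, ENNReal.ofReal (f x) ^ p ≠ ∞),
    ∑' x, G d f x ^ (p / 2) ≤ ENNReal.ofReal K * ∑' x, ENNReal.ofReal (f x) ^ p := by
  obtain ⟨K, hK, hmain⟩ := sqB1 p hp
  have hp2 : 0 < p - 2 := by linarith
  have hp0 : 0 < p := by linarith
  have hs : 0 < p / (p - 2) := by positivity
  set c : ℝ := (2 * K) ^ (-((p - 2) / 2)) with hc
  have hc0 : 0 < c := by positivity
  have hcs : K * c ^ (p / (p - 2)) = c / 2 := by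
    have e : c ^ (p / (p - 2)) = c * c ^ (2 / (p - 2)) := by
      rw [← Real.rpow_one_add' hc0.le (by positivity)]
      congr 1
      field_simp
      ring
    have e2 : c ^ (2 / (p - 2)) = (2 * K)⁻¹ := by
      rw [hc, ← Real.rpow_mul (by positivity), show -((p - 2) / 2) * (2 / (p - 2)) = -1 by field_simp, Real.rpow_neg_one]
    rw [e, e2]; field_simp
  refine ⟨2 * K / c, by positivity, ?_⟩
  intro d f B hf0 hfB hf
  by_cases hz : ∀ y, f y = 0
  · simp only [G_zero hz]
    rw [ENNReal.zero_rpow_of_pos (by linarith)]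
    simp
  push Not at hz
  obtain ⟨y0, hy0⟩ := hz
  -- general finitely supported test
  have test : ∀ (F : Finset (Fin d → ℤ)) (φ : (Fin d → ℤ) → ℝ), (∀ y, 0 ≤ φ y) → (∀ y ∉ F, φ y = 0) → (∃ y, φ y ≠ 0) →
      ∑ x ∈ F, ENNReal.ofReal (φ x) * G d f x ≤ ENNReal.ofReal K *
      (∑' x, ENNReal.ofReal (f x) ^ p + ∑ x ∈ F, ENNReal.ofReal (φ x) ^ (p / (p - 2))) := by
    intro F φ h0 hF ⟨y1, hy1⟩
    have e2 : ∑' x, ENNReal.ofReal (φ x) ^ (p / (p - 2)) = ∑ x ∈ F, ENNReal.ofReal (φ x) ^ (p / (p - 2)) :=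
      tsum_eq_sum fun x hx => by rw [hF x hx, ENNReal.ofReal_zero, ENNReal.zero_rpow_of_pos hs]
    rw [← e2]
    refine (ENNReal.sum_le_tsum F).trans
      (hmain d f φ (B + ∑ x ∈ F, φ x) hf0 (fun y => (hfB y).trans ?_) hf y0 hy0 h0 (fun y => ?_) ?_ y1 hy1)
    · have := Finset.sum_nonneg fun x (_ : x ∈ F) => h0 x
      linarith
    · have hB0 : 0 ≤ B := (abs_nonneg _).trans (hfB y)
      rw [abs_of_nonneg (h0 y)]
      by_cases hy : y ∈ F
      · have := Finset.single_le_sum (fun x (_ : x ∈ F) => h0 x) hy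
        linarith
      · rw [hF y hy]
        have := Finset.sum_nonneg fun x (_ : x ∈ F) => h0 x
        linarith
    · rw [e2]
      exact ENNReal.sum_ne_top.2 fun x _ => ENNReal.rpow_ne_top_of_nonneg hs.le ENNReal.ofReal_ne_top
  have hGt : ∀ x, G d f x ≠ ∞ := by
    intro x
    classical
    have := test {x} (fun y => if y = x then 1 else 0) (fun y => by positivity) (fun y hy => by simpa using hy)
      ⟨x, by simp⟩
    simp only [Finset.sum_singleton, if_true, ENNReal.ofReal_one, one_mul, ENNReal.one_rpow] at this
    exact (this.trans_lt (ENNReal.mul_lt_top ENNReal.ofReal_lt_top (ENNReal.add_lt_top.2 ⟨hf.lt_top, ENNReal.one_lt_top⟩))).ne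
  rw [ENNReal.tsum_eq_iSup_sum]
  refine iSup_le fun F => ?_
  classical
  set g : (Fin d → ℤ) → ℝ := fun x => (G d f x).toReal with hg
  have hg0 : ∀ x, 0 ≤ g x := fun x => ENNReal.toReal_nonneg
  have hGg : ∀ x, G d f x = ENNReal.ofReal (g x) := fun x => (ENNReal.ofReal_toReal (hGt x)).symm
  have hr : 0 < p / 2 - 1 := by linarith
  by_cases hgz : ∀ x ∈ F, g x = 0
  · rw [Finset.sum_eq_zero]
    · exact zero_le
    · intro x hx
      rw [hGg, hgz x hx, ENNReal.ofReal_zero, ENNReal.zero_rpow_of_pos (by positivity)]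
  push Not at hgz
  obtain ⟨y1, hy1F, hy1⟩ := hgz
  have hgy1 : 0 < g y1 := lt_of_le_of_ne (hg0 _) hy1.symm
  set φ : (Fin d → ℤ) → ℝ := fun x => if x ∈ F then c * g x ^ (p / 2 - 1) else 0 with hφ
  have ht := test F φ (fun y => by have := hg0 y; simp only [hφ]; split_ifs <;> positivity) (fun y hy => by simp [hφ, hy])
    ⟨y1, by simp only [hφ, hy1F, if_true]; positivity⟩
  set A : ℝ := ∑ x ∈ F, g x ^ (p / 2) with hA
  have hA0 : 0 ≤ A := Finset.sum_nonneg fun x _ => Real.rpow_nonneg (hg0 x) _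
  have e1 : ∑ x ∈ F, ENNReal.ofReal (φ x) * G d f x = ENNReal.ofReal (c * A) := by
    rw [hA, Finset.mul_sum, ENNReal.ofReal_sum_of_nonneg (fun x _ => by have := hg0 x; positivity)]
    refine Finset.sum_congr rfl fun x hx => ?_
    have := hg0 x
    rw [hGg, ← ENNReal.ofReal_mul' (hg0 x)]
    simp only [hφ, hx, if_true]
    rw [mul_assoc, ← Real.rpow_add_one' (hg0 x) (by linarith)]
    congr 3
    ring
  have e2 : ∑ x ∈ F, ENNReal.ofReal (φ x) ^ (p / (p - 2)) = ENNReal.ofReal (c ^ (p / (p - 2)) * A) := by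
    rw [hA, Finset.mul_sum, ENNReal.ofReal_sum_of_nonneg (fun x _ => by have := hg0 x; positivity)]
    refine Finset.sum_congr rfl fun x hx => ?_
    have := hg0 x
    simp only [hφ, hx, if_true]
    rw [ENNReal.ofReal_rpow_of_nonneg (by positivity) hs.le, Real.mul_rpow hc0.le (by positivity), ← Real.rpow_mul this]
    congr 3
    field_simp
  have e3 : ∑ x ∈ F, G d f x ^ (p / 2) = ENNReal.ofReal A := by
    rw [hA, ENNReal.ofReal_sum_of_nonneg (fun x _ => by have := hg0 x; positivity)]
    refine Finset.sum_congr rfl fun x hx => ?_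
    rw [hGg, ENNReal.ofReal_rpow_of_nonneg (hg0 x) (by positivity)]
  rw [e1, e2] at ht
  rw [e3]
  clear e1 e2 e3
  clear_value A φ g c
  obtain ⟨L, hL0, hL⟩ : ∃ L : ℝ, 0 ≤ L ∧ ∑' x, ENNReal.ofReal (f x) ^ p = ENNReal.ofReal L :=
    ⟨_, ENNReal.toReal_nonneg, (ENNReal.ofReal_toReal hf).symm⟩
  rw [hL] at ht ⊢
  rw [← ENNReal.ofReal_add hL0 (by positivity), ← ENNReal.ofReal_mul hK.le, ENNReal.ofReal_le_ofReal_iff (by positivity)] at ht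
  have hKc : 0 ≤ 2 * K / c := by positivity
  rw [← ENNReal.ofReal_mul hKc]
  refine ENNReal.ofReal_le_ofReal ?_
  have h5 : K * (L + c ^ (p / (p - 2)) * A) = K * L + c / 2 * A := by rw [← hcs]; ring
  rw [h5] at ht
  rw [div_mul_eq_mul_div, le_div_iff₀ hc0]
  linarith

lemma sq (p : ℝ) (hp : 1 < p) : ∃ K : ℝ, 0 < K ∧ ∀ (d : ℕ) (f : (Fin d → ℤ) → ℝ) (B : ℝ)
    (_ : ∀ y, 0 ≤ f y) (_ : ∀ y, |f y| ≤ B) (_ : ∑' x, ENNReal.ofReal (f x) ^ p ≠ ∞),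
    ∑' x, G d f x ^ (p / 2) ≤ ENNReal.ofReal K * ∑' x, ENNReal.ofReal (f x) ^ p := by
  rcases le_or_gt p 2 with h | h
  · have : 0 < p - 1 := by linarith
    exact ⟨_, by positivity, fun d f B h0 h1 h2 => sqA p hp h h0 h1 h2⟩
  · exact sqB p h

end PS


namespace PS

lemma lpZ_eq {d : ℕ} (p : ℝ) (hp : 1 < p) (g : (Fin d → ℤ) → ℝ≥0∞) :
    lpZ d (ENNReal.ofReal p) g = (∑' x, g x ^ p) ^ (1 / p) := by
  unfold lpZ
  rw [if_neg ENNReal.ofReal_ne_top, ENNReal.toReal_ofReal (by linarith)]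

lemma lp_conv {d : ℕ} (p : ℝ) (hp : 1 < p) (g h : (Fin d → ℤ) → ℝ≥0∞) (K C : ℝ) (hK : 0 ≤ K) (hC : K ^ (1 / p) ≤ C)
    (H : ∑' x, g x ^ p ≤ ENNReal.ofReal K * ∑' x, h x ^ p) :
    lpZ d (ENNReal.ofReal p) g ≤ ENNReal.ofReal C * lpZ d (ENNReal.ofReal p) h := by
  have hp0 : 0 < p := by linarith
  rw [lpZ_eq p hp, lpZ_eq p hp]
  refine (ENNReal.rpow_le_rpow H (by positivity)).trans ?_
  rw [ENNReal.mul_rpow_of_nonneg _ _ (by positivity), ENNReal.ofReal_rpow_of_nonneg hK (by positivity)]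
  exact mul_le_mul_left (ENNReal.ofReal_le_ofReal hC) _

noncomputable def wt : Fin 4 → ℂ := ![1, -1, Complex.I, -Complex.I]

noncomputable def pa {d : ℕ} (f : (Fin d → ℤ) → ℂ) : Fin 4 → (Fin d → ℤ) → ℝ :=
  ![fun y => max (f y).re 0, fun y => max (-(f y).re) 0, fun y => max (f y).im 0, fun y => max (-(f y).im) 0]

lemma wt_norm (i : Fin 4) : ‖wt i‖ = 1 := by fin_cases i <;> simp [wt]

lemma pa_nonneg {d : ℕ} (f : (Fin d → ℤ) → ℂ) (i : Fin 4) (y : Fin d → ℤ) : 0 ≤ pa f i y := by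
  fin_cases i <;> simp [pa]

lemma pa_le {d : ℕ} (f : (Fin d → ℤ) → ℂ) (i : Fin 4) (y : Fin d → ℤ) : pa f i y ≤ ‖f y‖ := by
  have h1 := Complex.abs_re_le_norm (f y)
  have h2 := Complex.abs_im_le_norm (f y)
  have h3 := abs_le.1 h1
  have h4 := abs_le.1 h2
  have h0 := norm_nonneg (f y)
  fin_cases i <;> simp [pa] <;> linarith

lemma max_sub (a : ℝ) : max a 0 - max (-a) 0 = a := by
  rcases le_total 0 a with h | h
  · rw [max_eq_left h, max_eq_right (by linarith)]; ring
  · rw [max_eq_right h, max_eq_left (by linarith)]; ring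

lemma pa_sum {d : ℕ} (f : (Fin d → ℤ) → ℂ) (y : Fin d → ℤ) : ∑ i, wt i * (pa f i y : ℂ) = f y := by
  have h1 := max_sub (f y).re
  have h2 := max_sub (f y).im
  simp only [Fin.sum_univ_four, wt, pa]
  apply Complex.ext
  · simp
    linarith
  · simp
    linarith

lemma poisson_eq {d : ℕ} {t : ℝ} (ht : 0 < t) (f : (Fin d → ℤ) → ℂ) {B : ℝ} (hB : ∀ y, ‖f y‖ ≤ B) (x : Fin d → ℤ) :
    poisson d t f x = ∑ i, wt i * (U d 0 (pa f i) t x : ℂ) := by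
  have hb : ∀ i y, |pa f i y| ≤ B := fun i y => by
    rw [abs_of_nonneg (pa_nonneg f i y)]; exact (pa_le f i y).trans (hB y)
  have hS : ∀ i, HasSum (fun y => wt i * (((J d 0 t (x - y) * pa f i y : ℝ)) : ℂ)) (wt i * (U d 0 (pa f i) t x : ℂ)) :=
    fun i => (Complex.hasSum_ofReal.2 (U_summable ht 0 (by norm_num) (hb i) x).hasSum).mul_left _
  have := hasSum_sum (s := Finset.univ) fun i _ => hS i
  rw [← this.tsum_eq]
  unfold poisson
  refine tsum_congr fun y => ?_
  rw [ker_eq, ← pa_sum f y, Finset.mul_sum]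
  refine Finset.sum_congr rfl fun i _ => ?_
  push_cast
  ring

lemma poisson_deriv {d : ℕ} {t : ℝ} (ht : 0 < t) (f : (Fin d → ℤ) → ℂ) {B : ℝ} (hB : ∀ y, ‖f y‖ ≤ B) (x : Fin d → ℤ) :
    deriv (fun s => poisson d s f x) t = ∑ i, wt i * ((-U d 1 (pa f i) t x : ℝ) : ℂ) := by
  have hb : ∀ i y, |pa f i y| ≤ B := fun i y => by
    rw [abs_of_nonneg (pa_nonneg f i y)]; exact (pa_le f i y).trans (hB y)
  have h1 : HasDerivAt (fun s => ∑ i, wt i * (U d 0 (pa f i) s x : ℂ))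
      (∑ i, wt i * ((-U d 1 (pa f i) t x : ℝ) : ℂ)) t :=
    HasDerivAt.fun_sum fun i _ => ((U_hasDerivAt ht 0 (by norm_num) (hb i) x).ofReal_comp).const_mul _
  refine (h1.congr_of_eventuallyEq ?_).deriv
  filter_upwards [lt_mem_nhds ht] with s hs
  exact poisson_eq hs f hB x

lemma deriv_sq {d : ℕ} {t : ℝ} (ht : 0 < t) (f : (Fin d → ℤ) → ℂ) {B : ℝ} (hB : ∀ y, ‖f y‖ ≤ B) (x : Fin d → ℤ) :
    (‖deriv (fun s => poisson d s f x) t‖₊ : ℝ≥0∞) ^ 2 ≤ 4 * ∑ i, ENNReal.ofReal (U d 1 (pa f i) t x ^ 2) := by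
  have h1 : ‖deriv (fun s => poisson d s f x) t‖ ≤ ∑ i, |U d 1 (pa f i) t x| := by
    rw [poisson_deriv ht f hB x]
    refine (norm_sum_le _ _).trans (le_of_eq (Finset.sum_congr rfl fun i _ => ?_))
    rw [norm_mul, wt_norm, one_mul, Complex.norm_real, Real.norm_eq_abs, abs_neg]
  have h2 : ‖deriv (fun s => poisson d s f x) t‖ ^ 2 ≤ 4 * ∑ i, U d 1 (pa f i) t x ^ 2 := by
    refine (pow_le_pow_left₀ (norm_nonneg _) h1 2).trans ?_
    have := sq_sum_le_card_mul_sum_sq (s := (Finset.univ : Finset (Fin 4))) (f := fun i => |U d 1 (pa f i) t x|)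
    simpa using this
  have e : (‖deriv (fun s => poisson d s f x) t‖₊ : ℝ≥0∞) ^ 2 = ENNReal.ofReal (‖deriv (fun s => poisson d s f x) t‖ ^ 2) := by
    rw [ENNReal.ofReal_pow (norm_nonneg _), ofReal_norm]; rfl
  rw [e]
  refine (ENNReal.ofReal_le_ofReal h2).trans (le_of_eq ?_)
  rw [ENNReal.ofReal_mul (by norm_num), ENNReal.ofReal_sum_of_nonneg (fun i _ => sq_nonneg _)]
  simp

lemma Gc_le {d : ℕ} (f : (Fin d → ℤ) → ℂ) {B : ℝ} (hB : ∀ y, ‖f y‖ ≤ B) (x : Fin d → ℤ) :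
    ∫⁻ t in Set.Ioi (0 : ℝ), ENNReal.ofReal t * (‖deriv (fun s => poisson d s f x) t‖₊ : ℝ≥0∞) ^ 2
      ≤ 4 * ∑ i, G d (pa f i) x := by
  have hb : ∀ i y, |pa f i y| ≤ B := fun i y => by
    rw [abs_of_nonneg (pa_nonneg f i y)]; exact (pa_le f i y).trans (hB y)
  unfold G
  rw [← lintegral_finsetSum', ← lintegral_const_mul' _ _ (by norm_num)]
  · refine setLIntegral_mono' measurableSet_Ioi fun t ht => ?_
    rw [← Finset.mul_sum, mul_left_comm]
    exact mul_le_mul_right (deriv_sq ht f hB x) _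
  · intro i _
    exact AEMeasurable.mul (by fun_prop) (AEMeasurable.ennreal_ofReal
      (ContinuousOn.aemeasurable ((U_cont 1 le_rfl (hb i) x).pow 2) measurableSet_Ioi))

lemma four_pow (r : ℝ) (hr : 0 < r) (a : Fin 4 → ℝ≥0∞) :
    (4 * ∑ i, a i) ^ r ≤ ENNReal.ofReal (16 ^ r) * ∑ i, a i ^ r := by
  obtain ⟨i, -, hi⟩ := Finset.exists_max_image (Finset.univ : Finset (Fin 4)) a ⟨0, by simp⟩
  have h1 : ∑ j, a j ≤ 4 * a i := by
    refine (Finset.sum_le_sum fun j _ => hi j (by simp)).trans (le_of_eq ?_)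
    simp
  calc (4 * ∑ i, a i) ^ r ≤ (16 * a i) ^ r := by
        refine ENNReal.rpow_le_rpow ((mul_le_mul_right h1 4).trans (le_of_eq ?_)) hr.le
        rw [← mul_assoc]; norm_num
    _ = ENNReal.ofReal (16 ^ r) * a i ^ r := by
        rw [ENNReal.mul_rpow_of_nonneg _ _ hr.le, ← ENNReal.ofReal_rpow_of_nonneg (by norm_num) hr.le]; simp
    _ ≤ _ := mul_le_mul_right (Finset.single_le_sum (f := fun i => a i ^ r) (fun _ _ => zero_le) (Finset.mem_univ i)) _

lemma poisson_nn {d : ℕ} {t : ℝ} (ht : 0 < t) (f : (Fin d → ℤ) → ℂ) {B : ℝ} (hB : ∀ y, ‖f y‖ ≤ B) (x : Fin d → ℤ) :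
    (‖poisson d t (fun y => (‖f y‖ : ℂ)) x‖₊ : ℝ≥0∞) = PE d t (nnC f) x := by
  have hb : ∀ y, |‖f y‖| ≤ B := fun y => by rw [abs_norm]; exact hB y
  have e : poisson d t (fun y => (‖f y‖ : ℂ)) x = ((U d 0 (fun y => ‖f y‖) t x : ℝ) : ℂ) := by
    unfold poisson U
    rw [Complex.ofReal_tsum]
    refine tsum_congr fun y => ?_
    rw [ker_eq]; push_cast; rfl
  have e2 : nnC f = fun y => ENNReal.ofReal ‖f y‖ := by
    funext y
    rw [ofReal_norm]; rfl
  have h := ofReal_U ht hb (fun y => norm_nonneg _) x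
  rw [e, e2, ← h]
  have h0 := U_nonneg ht.le (fun y => norm_nonneg (f y)) x
  have h3 : ‖((U d 0 (fun y => ‖f y‖) t x : ℝ) : ℂ)‖ = U d 0 (fun y => ‖f y‖) t x := by
    rw [Complex.norm_real, Real.norm_eq_abs, abs_of_nonneg h0]
  conv_rhs => rw [← h3]
  rw [ofReal_norm]; rfl

end PS
open PS

/-- dimension-free bounds on ℓ^p(ℤ^d), p ∈ (1,∞), for (i) the maximal
function of the Poisson semigroup and (ii) its Littlewood–Paley square function
(Lemma 4.2). -/
theorem statement12 (p : ℝ) (hp : 1 < p) :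
    ∃ C : ℝ, 0 < C ∧ ∀ (d : ℕ) (f : (Fin d → ℤ) → ℂ),
      lpZ d (ENNReal.ofReal p) (nnC f) ≠ ∞ →
      lpZ d (ENNReal.ofReal p)
          (fun x => ⨆ t : {t : ℝ // 0 < t},
            (‖poisson d (↑t) (fun y => (‖f y‖ : ℂ)) x‖₊ : ℝ≥0∞))
        ≤ ENNReal.ofReal C * lpZ d (ENNReal.ofReal p) (nnC f) ∧
      lpZ d (ENNReal.ofReal p)
          (fun x => (∫⁻ t in Set.Ioi (0 : ℝ),
              ENNReal.ofReal t * (‖deriv (fun s => poisson d s f x) t‖₊ : ℝ≥0∞) ^ 2)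
            ^ (1 / 2 : ℝ))
        ≤ ENNReal.ofReal C * lpZ d (ENNReal.ofReal p) (nnC f) := by
  have hp0 : 0 < p := by linarith
  have hp1 : 0 < p - 1 := by linarith
  obtain ⟨K, hK, hsq⟩ := sq p hp
  refine ⟨(8 ^ p * (p / (p - 1))) ^ (1 / p) + (16 ^ (p / 2) * (4 * K)) ^ (1 / p), by positivity, ?_⟩
  intro d f hf
  have hS : ∑' x, nnC f x ^ p ≠ ∞ := by
    intro h
    rw [lpZ_eq p hp, h, ENNReal.top_rpow_of_pos (by positivity)] at hf
    exact hf rfl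
  have hnB : ∀ y, nnC f y ≤ lpZ d (ENNReal.ofReal p) (nnC f) := by
    intro y
    rw [lpZ_eq p hp]
    calc nnC f y = (nnC f y ^ p) ^ (1 / p) := by rw [← ENNReal.rpow_mul, mul_one_div_cancel hp0.ne', ENNReal.rpow_one]
      _ ≤ _ := ENNReal.rpow_le_rpow (ENNReal.le_tsum y) (by positivity)
  have e2 : ∀ y, nnC f y = ENNReal.ofReal ‖f y‖ := by
    intro y
    rw [ofReal_norm]; rfl
  have hB : ∀ y, ‖f y‖ ≤ (lpZ d (ENNReal.ofReal p) (nnC f)).toReal := by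
    intro y
    have := hnB y
    rw [e2 y] at this
    exact (ENNReal.ofReal_le_iff_le_toReal hf).1 this
  constructor
  · refine lp_conv p hp _ _ (8 ^ p * (p / (p - 1))) _ (by positivity) (le_add_of_nonneg_right (by positivity)) ?_
    refine le_trans (le_of_eq (tsum_congr fun x => ?_)) (maximal p hp (nnC f) _ hf hnB)
    congr 1
    exact iSup_congr fun t => poisson_nn t.2 f hB x
  · refine lp_conv p hp _ _ (16 ^ (p / 2) * (4 * K)) _ (by positivity) (le_add_of_nonneg_left (by positivity)) ?_
    have hle : ∀ i, ∑' x, ENNReal.ofReal (pa f i x) ^ p ≤ ∑' x, nnC f x ^ p := fun i =>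
      ENNReal.tsum_le_tsum fun x => ENNReal.rpow_le_rpow (by
        rw [e2]; exact ENNReal.ofReal_le_ofReal (pa_le f i x)) hp0.le
    calc _ ≤ ∑' x, ENNReal.ofReal (16 ^ (p / 2)) * ∑ i, G d (pa f i) x ^ (p / 2) := by
          refine ENNReal.tsum_le_tsum fun x => ?_
          rw [← ENNReal.rpow_mul, show (1 / 2 : ℝ) * p = p / 2 by ring]
          exact (ENNReal.rpow_le_rpow (Gc_le f hB x) (by positivity)).trans (four_pow _ (by positivity) _)
      _ = ENNReal.ofReal (16 ^ (p / 2)) * ∑ i, ∑' x, G d (pa f i) x ^ (p / 2) := by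
          rw [ENNReal.tsum_mul_left, Summable.tsum_finsetSum fun i _ => ENNReal.summable]
      _ ≤ ENNReal.ofReal (16 ^ (p / 2)) * ∑ i : Fin 4, ENNReal.ofReal K * ∑' x, nnC f x ^ p := by
          refine mul_le_mul_right (Finset.sum_le_sum fun i _ => ?_) _
          refine (hsq d (pa f i) (lpZ d (ENNReal.ofReal p) (nnC f)).toReal (pa_nonneg f i) (fun y => ?_) (ne_top_of_le_ne_top hS (hle i))).trans
            (mul_le_mul_right (hle i) _)
          · rw [abs_of_nonneg (pa_nonneg f i y)]
            exact (pa_le f i y).trans (hB y)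
      _ = _ := by
          rw [Finset.sum_const, ENNReal.ofReal_mul (by positivity), ENNReal.ofReal_mul (by norm_num)]
          simp
          ring
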